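/- arXiv:2507.05242 — 5 statements merged into one kernel-verified Lean document; each statement's English description precedes it below -/
import Mathlib

section
/- Let A and B be n×n complex positive semidefinite matrices, and let f : ℝ → ℝ be a function that is nonnegative and monotone nondecreasing on an interval J containing the spectrum of A. Then for every s ∈ [0,1], Tr[f(A) · A^s · B^s] ≤ Tr[f(A) · (A^{1/2} B A^{1/2})^s]. (Both traces are real numbers, since f(A)A^s is positive semidefinite and commutes with A; equivalently the inequality holds between the real parts of the two traces.) -/
open scoped ComplexOrder

/-- `mpow A s` is the matrix power `A ^ s` (for real `s`) defined via the continuous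
functional calculus: if `A = Σ_i λ_i P_i` is a spectral decomposition, `mpow A s = Σ_i λ_i ^ s • P_i`. -/
noncomputable def mpow {m : ℕ} (A : Matrix (Fin m) (Fin m) ℂ) (s : ℝ) :
    Matrix (Fin m) (Fin m) ℂ :=
  cfc (fun x : ℝ => x ^ s) A

/-- `mfun f A` is `f(A)` defined via the continuous functional calculus:
if `A = Σ_i λ_i P_i` is a spectral decomposition, `mfun f A = Σ_i f (λ_i) • P_i`. -/
noncomputable def mfun {m : ℕ} (f : ℝ → ℝ) (A : Matrix (Fin m) (Fin m) ℂ) :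
    Matrix (Fin m) (Fin m) ℂ :=
  cfc f A


namespace TrAux
section

lemma abel_aux {ι : Type*} [Fintype ι] (D : ι → ℝ) :
    ∀ (k : ℕ) (g : ι → ℝ), (∀ i, 0 ≤ g i) →
      (Finset.univ.filter (fun i => 0 < g i)).card ≤ k →
      (∀ c > 0, 0 ≤ ∑ i ∈ Finset.univ.filter (fun i => c ≤ g i), D i) →
      0 ≤ ∑ i, g i * D i := by
  intro k
  induction k with
  | zero =>
    intro g hg hk _
    apply le_of_eq
    symm
    apply Finset.sum_eq_zero
    intro i _
    have h0 : g i = 0 := by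
      by_contra h
      have hp : 0 < g i := lt_of_le_of_ne (hg i) (Ne.symm h)
      have : i ∈ Finset.univ.filter (fun i => 0 < g i) := by simp [hp]
      have := Finset.card_pos.mpr ⟨i, this⟩
      omega
    simp [h0]
  | succ k ih =>
    intro g hg hk h
    classical
    set S := Finset.univ.filter (fun i => 0 < g i) with hS
    by_cases hne : S.Nonempty
    · obtain ⟨j, hj, hmin⟩ := S.exists_min_image g hne
      have hjp : 0 < g j := by simpa [hS] using hj
      set g' : ι → ℝ := fun i => if 0 < g i then g i - g j else 0 with hg'
      have hmin' : ∀ i, 0 < g i → g j ≤ g i := fun i hi => hmin i (by simp [hS, hi])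
      have h1 : 0 ≤ ∑ i, g' i * D i := by
        apply ih
        · intro i
          simp only [hg']
          split_ifs with hi
          · linarith [hmin' i hi]
          · exact le_rfl
        · have hsub : Finset.univ.filter (fun i => 0 < g' i) ⊆ S.erase j := by
            intro i hi
            simp only [hg', Finset.mem_filter, Finset.mem_univ, true_and] at hi
            split_ifs at hi with hi'
            · rw [Finset.mem_erase]
              refine ⟨?_, by simp [hS, hi']⟩
              rintro rfl
              simp at hi
            · exact absurd hi (lt_irrefl _)
          have := Finset.card_le_card hsub
          rw [Finset.card_erase_of_mem hj] at this
          omega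
        · intro c hc
          have := h (c + g j) (by linarith)
          convert this using 2
          ext i
          simp only [hg', Finset.mem_filter, Finset.mem_univ, true_and]
          split_ifs with hi
          · constructor <;> intro <;> linarith
          · constructor <;> intro <;> linarith
      have h2 : ∑ i, g i * D i = ∑ i, g' i * D i + g j * ∑ i ∈ S, D i := by
        rw [Finset.mul_sum, hS, Finset.sum_filter, ← Finset.sum_add_distrib]
        apply Finset.sum_congr rfl
        intro i _
        simp only [hg']
        split_ifs with hi
        · ring
        · have : g i = 0 := le_antisymm (not_lt.mp hi) (hg i)
          simp [this]
      have h3 : S = Finset.univ.filter (fun i => g j ≤ g i) := by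
        ext i
        simp only [hS, Finset.mem_filter, Finset.mem_univ, true_and]
        exact ⟨hmin' i, fun h => lt_of_lt_of_le hjp h⟩
      rw [h2]
      have := h (g j) hjp
      rw [← h3] at this
      positivity
    · apply ih g hg _ h
      rw [Finset.not_nonempty_iff_eq_empty] at hne
      rw [← hS, hne]; simp

lemma rpow_diff (s : ℝ) (hs0 : 0 < s) (hs1 : s < 1) (u v x : ℝ) (hu : 0 < u) (huv : u ≤ v) :
    s * u ^ (s - 1) * (max x v - max x u) ≤ (v / u) ^ (1 - s) * ((max x v) ^ s - (max x u) ^ s) := by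
  have hv : 0 < v := lt_of_lt_of_le hu huv
  by_cases hx : v ≤ x
  · rw [max_eq_left hx, max_eq_left (huv.trans hx)]; simp
  · push Not at hx
    rw [max_eq_right hx.le]
    set w := max x u with hw
    have hw0 : 0 < w := lt_of_lt_of_le hu (le_max_right _ _)
    have hwv : w ≤ v := max_le hx.le huv
    -- tangent: w^s ≤ v^s + s v^(s-1) (w - v)
    have ht : w ^ s ≤ v ^ s + s * v ^ (s - 1) * (w - v) := by
      have h := rpow_one_add_le_one_add_mul_self (s := w / v - 1) (p := s)
        (by have : 0 < w / v := by positivity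
            linarith) hs0.le hs1.le
      rw [add_sub_cancel, Real.div_rpow hw0.le hv.le, div_le_iff₀ (by positivity)] at h
      rw [Real.rpow_sub_one hv.ne']
      calc _ ≤ _ := h
        _ = _ := by field_simp
    have e : (v / u) ^ (1 - s) * v ^ (s - 1) = u ^ (s - 1) := by
      rw [Real.div_rpow hv.le hu.le, show (s - 1) = -(1 - s) by ring, Real.rpow_neg hv.le,
        Real.rpow_neg hu.le]
      have := Real.rpow_pos_of_pos hv (1 - s)
      field_simp
    have hp : 0 < (v / u) ^ (1 - s) := by positivity
    rw [← e]
    have := mul_le_mul_of_nonneg_left (show s * v ^ (s - 1) * (v - w) ≤ v ^ s - w ^ s by linarith) hp.le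
    linarith

lemma scalar_alt {ι : Type*} [Fintype ι] (s : ℝ) (hs0 : 0 < s) (hs1 : s < 1)
    (y : (ι → ℝ) → ι → ℝ) (β : ι → ℝ) (hβ : ∀ i, 0 ≤ β i)
    (ha : ∀ a a' : ι → ℝ, (∀ i, 0 < a i) → (∀ i, a i ≤ a' i) → ∀ i, y a' i ≤ y a i)
    (hc : ∀ T : ℝ, 0 < T → ∀ i, y (fun _ => T) i = T ^ (s - 1) * β i)
    (hd : ∀ a a' : ι → ℝ, (∀ i, 0 < a i) → (∀ i, 0 < a' i) →
      ∑ i, a' i * y a' i ≤ (1 - s) * ∑ i, a i * y a i + s * ∑ i, a' i * y a i)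
    (a : ι → ℝ) (ha0 : ∀ i, 0 < a i) :
    ∑ i, a i ^ s * β i ≤ ∑ i, a i * y a i := by
  set A : ℝ → ι → ℝ := fun u i => max (a i) u with hA
  set F : ℝ → ℝ := fun u => ∑ i, A u i * y (A u) i with hF
  set G : ℝ → ℝ := fun u => ∑ i, A u i ^ s * β i with hG
  have step : ∀ u v, 0 < u → u ≤ v → F v - F u ≤ (v / u) ^ (1 - s) * (G v - G u) := by
    intro u v hu huv
    have hAu : ∀ i, 0 < A u i := fun i => lt_of_lt_of_le hu (le_max_right _ _)
    have hAv : ∀ i, 0 < A v i := fun i => lt_of_lt_of_le (hu.trans_le huv) (le_max_right _ _)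
    have h1 := hd (A u) (A v) hAu hAv
    have h2 : ∑ i, s * ((A v i - A u i) * y (A u) i) ≤
        ∑ i, (v / u) ^ (1 - s) * ((A v i ^ s - A u i ^ s) * β i) := by
      apply Finset.sum_le_sum
      intro i _
      have h3 : y (A u) i ≤ u ^ (s - 1) * β i := by
        rw [← hc u hu]
        exact ha _ _ (fun _ => hu) (fun i => le_max_right _ _) i
      have h4 : 0 ≤ A v i - A u i := sub_nonneg.mpr (max_le_max le_rfl huv)
      have h5 := mul_le_mul_of_nonneg_right (rpow_diff s hs0 hs1 u v (a i) hu huv) (hβ i)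
      calc s * ((A v i - A u i) * y (A u) i) ≤ s * ((A v i - A u i) * (u ^ (s - 1) * β i)) := by
            gcongr
        _ ≤ _ := by simp only [hA]; linarith
    rw [← Finset.mul_sum, ← Finset.mul_sum] at h2
    simp only [sub_mul, Finset.sum_sub_distrib] at h2
    simp only [hF, hG]
    linarith
  obtain ⟨T₀, hT₀⟩ := (Set.finite_range a).bddAbove
  obtain ⟨δ₀, hδ₀⟩ := (Set.finite_range (fun i => (a i)⁻¹)).bddAbove
  set δ : ℝ := (max δ₀ 1)⁻¹ with hδ
  have hδp : 0 < δ := by positivity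
  have hδa : ∀ i, δ ≤ a i := by
    intro i
    have : (a i)⁻¹ ≤ max δ₀ 1 := (hδ₀ ⟨i, rfl⟩).trans (le_max_left _ _)
    rw [hδ]
    exact inv_le_of_inv_le₀ (ha0 i) this
  set T : ℝ := max T₀ δ with hT
  have hTa : ∀ i, a i ≤ T := fun i => (hT₀ ⟨i, rfl⟩).trans (le_max_left _ _)
  have hδT : δ ≤ T := le_max_right _ _
  have hTp : 0 < T := hδp.trans_le hδT
  have iter : ∀ r : ℝ, 1 ≤ r → ∀ k : ℕ, F (δ * r ^ k) - F δ ≤ r ^ (1 - s) * (G (δ * r ^ k) - G δ) := by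
    intro r hr k
    induction k with
    | zero => simp
    | succ k ih =>
      have hp : 0 < δ * r ^ k := by positivity
      have := step (δ * r ^ k) (δ * r ^ (k + 1)) hp (by gcongr; omega)
      rw [show δ * r ^ (k + 1) / (δ * r ^ k) = r by rw [pow_succ]; field_simp] at this
      linarith
  have lim : Filter.Tendsto (fun N : ℕ => ((T / δ) ^ ((1:ℝ) / (N + 1 : ℕ))) ^ (1 - s) * (G T - G δ))
      Filter.atTop (nhds (1 * (G T - G δ))) := by
    apply Filter.Tendsto.mul_const
    have h1 : Filter.Tendsto (fun N : ℕ => ((1:ℝ) / (N + 1 : ℕ))) Filter.atTop (nhds 0) := by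
      simpa using tendsto_one_div_add_atTop_nhds_zero_nat (𝕜 := ℝ)
    have h2 : Filter.Tendsto (fun N : ℕ => (T / δ) ^ ((1:ℝ) / (N + 1 : ℕ))) Filter.atTop (nhds 1) := by
      have := (tendsto_const_nhds (x := T / δ)).rpow h1 (Or.inl (by positivity))
      simpa using this
    have := h2.rpow_const (p := 1 - s) (Or.inl one_ne_zero)
    simpa using this
  have key : F T - F δ ≤ 1 * (G T - G δ) := by
    apply ge_of_tendsto' lim
    intro N
    have hr : 1 ≤ (T / δ) ^ ((1:ℝ) / (N + 1 : ℕ)) :=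
      Real.one_le_rpow ((one_le_div hδp).mpr hδT) (by positivity)
    have := iter _ hr (N + 1)
    rw [← Real.rpow_natCast, ← Real.rpow_mul (by positivity), one_div, inv_mul_cancel₀ (by positivity),
      Real.rpow_one, mul_div_cancel₀ _ hδp.ne'] at this
    simpa [one_div] using this
  have hAδ : A δ = a := by ext i; exact max_eq_left (hδa i)
  have hAT : A T = fun _ => T := by ext i; exact max_eq_right (hTa i)
  have hFG : F T = G T := by
    simp only [hF, hG, hAT]
    apply Finset.sum_congr rfl
    intro i _
    rw [hc T hTp, Real.rpow_sub_one hTp.ne']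
    field_simp
  have : G δ ≤ F δ := by linarith
  simpa only [hF, hG, hAδ] using this

lemma scalar_main {ι : Type*} [Fintype ι] (s : ℝ) (hs0 : 0 < s) (hs1 : s < 1)
    (y : (ι → ℝ) → ι → ℝ) (β : ι → ℝ) (hβ : ∀ i, 0 ≤ β i)
    (ha : ∀ a a' : ι → ℝ, (∀ i, 0 < a i) → (∀ i, a i ≤ a' i) → ∀ i, y a' i ≤ y a i)
    (hc : ∀ T : ℝ, 0 < T → ∀ i, y (fun _ => T) i = T ^ (s - 1) * β i)
    (hd : ∀ a a' : ι → ℝ, (∀ i, 0 < a i) → (∀ i, 0 < a' i) →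
      ∑ i, a' i * y a' i ≤ (1 - s) * ∑ i, a i * y a i + s * ∑ i, a' i * y a i)
    (a : ι → ℝ) (ha0 : ∀ i, 0 < a i) (g : ι → ℝ) (hg : ∀ i, 0 ≤ g i)
    (hga : ∀ i j, a i ≤ a j → g i ≤ g j) :
    ∑ i, g i * (a i ^ s * β i) ≤ ∑ i, g i * (a i * y a i) := by
  have level : ∀ t, 0 < t → 0 ≤ ∑ i ∈ Finset.univ.filter (fun i => t ≤ a i),
      (a i * y a i - a i ^ s * β i) := by
    intro t ht
    set A : ι → ℝ := fun i => max (a i) t with hA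
    have hAp : ∀ i, 0 < A i := fun i => lt_of_lt_of_le ht (le_max_right _ _)
    have h1 := scalar_alt s hs0 hs1 y β hβ ha hc hd A hAp
    have h2 : ∀ i, A i * y A i - A i ^ s * β i ≤ if t ≤ a i then a i * y a i - a i ^ s * β i else 0 := by
      intro i
      split_ifs with h
      · have : A i = a i := max_eq_left h
        rw [this]
        have := mul_le_mul_of_nonneg_left (ha a A ha0 (fun i => le_max_left _ _) i) (ha0 i).le
        linarith
      · have : A i = t := max_eq_right (not_le.mp h).le
        rw [this]
        have h3 := ha (fun _ => t) A (fun _ => ht) (fun i => le_max_right _ _) i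
        rw [hc t ht] at h3
        have := mul_le_mul_of_nonneg_left h3 ht.le
        have e : t * (t ^ (s - 1) * β i) = t ^ s * β i := by
          rw [Real.rpow_sub_one ht.ne']; field_simp
        linarith
    have h3 := Finset.sum_le_sum (fun i (_ : i ∈ Finset.univ) => h2 i)
    rw [Finset.sum_sub_distrib, ← Finset.sum_filter] at h3
    linarith
  have := abel_aux (fun i => a i * y a i - a i ^ s * β i) _ g hg le_rfl (by
    intro c hc
    by_cases hne : (Finset.univ.filter (fun i => c ≤ g i)).Nonempty
    · obtain ⟨j, hj, hmin⟩ := Finset.exists_min_image _ a hne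
      have e : Finset.univ.filter (fun i => c ≤ g i) = Finset.univ.filter (fun i => a j ≤ a i) := by
        ext i
        simp only [Finset.mem_filter, Finset.mem_univ, true_and] at hj hmin ⊢
        exact ⟨hmin i, fun h => hj.trans (hga _ _ h)⟩
      rw [e]
      exact level _ (ha0 j)
    · rw [Finset.not_nonempty_iff_eq_empty] at hne
      simp [hne])
  simp only [mul_sub, Finset.sum_sub_distrib] at this
  linarith

open scoped MatrixOrder

lemma cont_spec {n : ℕ} (g : ℝ → ℝ) (M : Matrix (Fin n) (Fin n) ℂ) :
    ContinuousOn g (spectrum ℝ M) :=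
  (Matrix.finite_real_spectrum (A := M)).continuousOn g

lemma exists_poly (g : ℝ → ℝ) (S : Set ℝ) (hS : S.Finite) :
    ∃ p : Polynomial ℝ, ∀ x ∈ S, p.eval x = g x := by
  classical
  refine ⟨Lagrange.interpolate hS.toFinset id g, fun x hx => ?_⟩
  have := Lagrange.eval_interpolate_at_node (s := hS.toFinset) (v := id) g
    (Function.injective_id.injOn) (i := x) (by simpa using hx)
  simpa using this

lemma intertwine {n : ℕ} (g : ℝ → ℝ) (X Y : Matrix (Fin n) (Fin n) ℂ)
    (h1 : IsSelfAdjoint (X * Y)) (h2 : IsSelfAdjoint (Y * X)) :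
    X * cfc g (Y * X) = cfc g (X * Y) * X := by
  obtain ⟨p, hp⟩ := exists_poly g (spectrum ℝ (X * Y) ∪ spectrum ℝ (Y * X))
    ((Matrix.finite_real_spectrum).union (Matrix.finite_real_spectrum))
  rw [cfc_congr (f := g) (g := p.eval) (a := Y * X) (fun x hx => (hp x (Or.inr hx)).symm),
    cfc_congr (f := g) (g := p.eval) (a := X * Y) (fun x hx => (hp x (Or.inl hx)).symm),
    cfc_polynomial p _ h1, cfc_polynomial p _ h2]
  clear hp
  induction p using Polynomial.induction_on' with
  | add p q hp' hq' => rw [map_add, map_add, mul_add, add_mul, hp', hq']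
  | monomial k c =>
    rw [Polynomial.aeval_monomial, Polynomial.aeval_monomial, ← Algebra.smul_def, ← Algebra.smul_def,
      mul_smul_comm, smul_mul_assoc]
    congr 1
    induction k with
    | zero => simp
    | succ k ih => rw [pow_succ, pow_succ, ← mul_assoc, ih]; simp only [mul_assoc]

lemma cfc_conj {n : ℕ} (g : ℝ → ℝ) (U M : Matrix (Fin n) (Fin n) ℂ)
    (hU : star U * U = 1) (hU' : U * star U = 1) (hM : IsSelfAdjoint M) :
    cfc g (U * M * star U) = U * cfc g M * star U := by
  have h := intertwine g U (M * star U) (by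
    rw [← mul_assoc]; exact hM.conjugate U) (by rw [mul_assoc, hU, mul_one]; exact hM)
  rw [mul_assoc M, hU, mul_one] at h
  rw [h, mul_assoc, mul_assoc, hU', mul_one]

open scoped Matrix.Norms.L2Operator in
lemma mpow_antitone {n : ℕ} (X Y : Matrix (Fin n) (Fin n) ℂ) (hX : X.PosDef) (hXY : X ≤ Y)
    (q : ℝ) (hq0 : -1 < q) (hq1 : q < 0) : mpow Y q ≤ mpow X q := by
  have hXs : IsStrictlyPositive X := hX.isStrictlyPositive
  have hYs : IsStrictlyPositive Y := hXs.of_le hXY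
  have h1 : X ^ (-q) ≤ Y ^ (-q) := CFC.rpow_le_rpow ⟨by linarith, by linarith⟩ hXY
  have h2 : IsStrictlyPositive (X ^ (-q)) := by
    exact IsStrictlyPositive.rpow X (-q) hXs
  have h3 := CStarAlgebra.rpow_neg_one_le_rpow_neg_one h1 h2
  rw [CFC.rpow_rpow _ _ _ (by linarith) hXs, CFC.rpow_rpow _ _ _ (by linarith) hYs] at h3
  rw [mul_neg_one, neg_neg, CFC.rpow_eq_cfc_real hXs.nonneg, CFC.rpow_eq_cfc_real hYs.nonneg] at h3
  exact h3

lemma spec_nonneg {n : ℕ} {M : Matrix (Fin n) (Fin n) ℂ} (hM : M.PosSemidef) :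
    ∀ x ∈ spectrum ℝ M, 0 ≤ x := fun _ hx =>
  spectrum_nonneg_of_nonneg hM.nonneg hx

lemma spec_pos {n : ℕ} {M : Matrix (Fin n) (Fin n) ℂ} (hM : M.PosDef) :
    ∀ x ∈ spectrum ℝ M, 0 < x := fun _ hx =>
  IsStrictlyPositive.spectrum_pos (𝕜 := ℝ) hM.isStrictlyPositive hx

lemma mpow_add {n : ℕ} {M : Matrix (Fin n) (Fin n) ℂ} (hM : M.PosDef) (p q : ℝ) :
    mpow M p * mpow M q = mpow M (p + q) := by
  unfold mpow
  rw [← cfc_mul _ _ M (cont_spec _ _) (cont_spec _ _)]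
  exact cfc_congr fun x hx => (Real.rpow_add (spec_pos hM x hx) p q).symm

lemma mpow_one {n : ℕ} {M : Matrix (Fin n) (Fin n) ℂ} (hM : M.PosSemidef) :
    mpow M 1 = M := by
  unfold mpow
  simp only [Real.rpow_one]
  exact cfc_id' ℝ M hM.isHermitian

lemma mpow_zero {n : ℕ} {M : Matrix (Fin n) (Fin n) ℂ} (hM : M.PosSemidef) :
    mpow M 0 = 1 := by
  unfold mpow
  simp only [Real.rpow_zero]
  exact cfc_const_one ℝ M hM.isHermitian

lemma mpow_psd {n : ℕ} {M : Matrix (Fin n) (Fin n) ℂ} (hM : M.PosSemidef) (p : ℝ) :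
    (mpow M p).PosSemidef := by
  rw [← Matrix.nonneg_iff_posSemidef]
  exact cfc_nonneg fun x hx => Real.rpow_nonneg (spec_nonneg hM x hx) p

lemma mpow_smul {n : ℕ} {M : Matrix (Fin n) (Fin n) ℂ} (hM : M.PosSemidef) (t : ℝ) (ht : 0 < t)
    (p : ℝ) : mpow (t • M) p = t ^ p • mpow M p := by
  unfold mpow
  refine (cfc_comp_smul t (fun x : ℝ => x ^ p) M
    ((Matrix.finite_real_spectrum.image _).continuousOn _) hM.isHermitian).symm.trans ?_
  refine Eq.trans ?_ (cfc_smul (t ^ p) (fun x : ℝ => x ^ p) M (cont_spec _ _))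
  exact cfc_congr fun x hx => by
    simp only [smul_eq_mul]
    exact Real.mul_rpow ht.le (spec_nonneg hM x hx)

lemma diag_re_mono {n : ℕ} {M N : Matrix (Fin n) (Fin n) ℂ} (h : M ≤ N) (i : Fin n) :
    (M i i).re ≤ (N i i).re := by
  have := (Matrix.le_iff.mp h).diag_nonneg (i := i)
  rw [Matrix.sub_apply] at this
  have := (Complex.le_def.mp this).1
  simp at this
  linarith

lemma klein {n : ℕ} {X Z : Matrix (Fin n) (Fin n) ℂ} (hX : X.PosDef) (hZ : Z.PosDef)
    (s : ℝ) (hs0 : 0 < s) (hs1 : s < 1) :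
    (mpow Z s).trace.re ≤ (1 - s) * (mpow X s).trace.re + s * (mpow X (s - 1) * Z).trace.re := by
  set hH := hX.isHermitian
  set U : Matrix (Fin n) (Fin n) ℂ := (hH.eigenvectorUnitary : Matrix (Fin n) (Fin n) ℂ) with hUdef
  have hU : star U * U = 1 := Unitary.coe_star_mul_self hH.eigenvectorUnitary
  have hU' : U * star U = 1 := Unitary.coe_mul_star_self hH.eigenvectorUnitary
  set x := hH.eigenvalues with hx
  have hxp : ∀ i, 0 < x i := hX.eigenvalues_pos
  have hcfc : ∀ g : ℝ → ℝ, cfc g X = U * Matrix.diagonal (fun i => ((g (x i) : ℝ) : ℂ)) * star U := by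
    intro g
    rw [hH.cfc_eq, Matrix.IsHermitian.cfc, Unitary.conjStarAlgAut_apply]
    rfl
  set M := star U * Z * U with hM
  have hMp : M.PosSemidef := by
    have := hZ.posSemidef.conjTranspose_mul_mul_same U
    exact this
  have e1 : (mpow Z s).trace = (mpow M s).trace := by
    unfold mpow
    have := cfc_conj (fun x => x ^ s) (star U) Z (by simpa using hU') (by simpa using hU) hZ.isHermitian
    rw [star_star] at this
    rw [hM, this, Matrix.trace_mul_comm, ← mul_assoc, hU', one_mul]
  have e2 : (mpow X s).trace.re = ∑ i, x i ^ s := by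
    unfold mpow
    rw [hcfc, Matrix.trace_mul_comm, ← mul_assoc, hU, one_mul, Matrix.trace_diagonal]
    simp
  have e3 : (mpow X (s - 1) * Z).trace.re = ∑ i, x i ^ (s - 1) * (M i i).re := by
    unfold mpow
    rw [hcfc, mul_assoc, mul_assoc, Matrix.trace_mul_comm, mul_assoc, ← hM, Matrix.trace]
    simp [Matrix.diagonal_mul]
  rw [e1, e2, e3, Finset.mul_sum, Finset.mul_sum, ← Finset.sum_add_distrib, Matrix.trace, Complex.re_sum]
  apply Finset.sum_le_sum
  intro i _
  have h : mpow M s ≤ cfc (fun z : ℝ => (1 - s) * x i ^ s + s * x i ^ (s - 1) * z) M := by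
    unfold mpow
    apply cfc_mono _ (cont_spec _ _) (cont_spec _ _)
    intro z hz
    have hz0 := spec_nonneg hMp z hz
    have hv := hxp i
    have h := rpow_one_add_le_one_add_mul_self (s := z / x i - 1) (p := s)
        (by have : 0 ≤ z / x i := by positivity
            linarith) hs0.le hs1.le
    rw [add_sub_cancel, Real.div_rpow hz0 hv.le, div_le_iff₀ (by positivity)] at h
    rw [Real.rpow_sub_one hv.ne']
    calc _ ≤ _ := h
      _ = _ := by field_simp; ring
  have h2 := diag_re_mono h i
  have e4 : cfc (fun z : ℝ => (1 - s) * x i ^ s + s * x i ^ (s - 1) * z) M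
      = ((1 - s) * x i ^ s) • (1 : Matrix (Fin n) (Fin n) ℂ) + (s * x i ^ (s - 1)) • M := by
    refine (cfc_const_add ((1 - s) * x i ^ s) (fun z => s * x i ^ (s - 1) * z) M
      (cont_spec _ _) hMp.isHermitian).trans ?_
    rw [Algebra.algebraMap_eq_smul_one]
    congr 1
    exact cfc_const_mul_id _ M hMp.isHermitian
  rw [e4] at h2
  simpa [mul_assoc] using h2

noncomputable def dg {n : ℕ} (a : Fin n → ℝ) : Matrix (Fin n) (Fin n) ℂ :=
  Matrix.diagonal (fun i => ((a i : ℝ) : ℂ))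

lemma dg_pd {n : ℕ} {a : Fin n → ℝ} (ha : ∀ i, 0 < a i) : (dg a).PosDef := by
  unfold dg
  rw [Matrix.posDef_diagonal_iff]
  intro i; exact_mod_cast ha i

lemma dg_psd {n : ℕ} {a : Fin n → ℝ} (ha : ∀ i, 0 ≤ a i) : (dg a).PosSemidef := by
  unfold dg
  rw [Matrix.posSemidef_diagonal_iff]
  intro i; exact_mod_cast ha i

lemma core {n : ℕ} {B : Matrix (Fin n) (Fin n) ℂ} (hB : B.PosDef)
    (s : ℝ) (hs0 : 0 < s) (hs1 : s < 1) (a : Fin n → ℝ) (ha0 : ∀ i, 0 < a i)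
    (g : Fin n → ℝ) (hg : ∀ i, 0 ≤ g i) (hga : ∀ i j, a i ≤ a j → g i ≤ g j) :
    ∑ i, g i * (a i ^ s * (mpow B s i i).re) ≤
      ∑ i, g i * (mpow (dg (fun i => a i ^ (1/2:ℝ)) * B * dg (fun i => a i ^ (1/2:ℝ))) s i i).re := by
  set R := mpow B (1/2) with hR
  have hRH : star R = R := (mpow_psd hB.posSemidef (1/2)).isHermitian
  have hRH' : R.conjTranspose = R := hRH
  have hRR : R * R = B := by
    rw [hR, mpow_add hB, add_halves, mpow_one hB.posSemidef]
  have hRu : IsUnit R := by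
    have h1 : R * mpow B (-(1/2)) = 1 := by
      rw [hR, mpow_add hB, add_neg_cancel, mpow_zero hB.posSemidef]
    have h2 : mpow B (-(1/2)) * R = 1 := by
      rw [hR, mpow_add hB, neg_add_cancel, mpow_zero hB.posSemidef]
    exact ⟨⟨R, _, h1, h2⟩, rfl⟩
  have hX : ∀ b : Fin n → ℝ, (∀ i, 0 < b i) → (R * dg b * R).PosDef := by
    intro b hb
    have := (dg_pd hb).conjTranspose_mul_mul_same (Matrix.mulVec_injective_of_isUnit hRu)
    rwa [hRH'] at this
  have hmono : ∀ M N : Matrix (Fin n) (Fin n) ℂ, M ≤ N → R * M * R ≤ R * N * R := by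
    intro M N h
    have := star_left_conjugate_le_conjugate h R
    rwa [hRH] at this
  set y : (Fin n → ℝ) → Fin n → ℝ := fun b i => ((R * mpow (R * dg b * R) (s - 1) * R) i i).re with hy
  have htr : ∀ b b' : Fin n → ℝ, (mpow (R * dg b * R) (s - 1) * (R * dg b' * R)).trace.re
      = ∑ i, b' i * y b i := by
    intro b b'
    have : (mpow (R * dg b * R) (s - 1) * (R * dg b' * R)).trace
      = (dg b' * (R * mpow (R * dg b * R) (s - 1) * R)).trace := by
      rw [← mul_assoc, Matrix.trace_mul_comm, ← mul_assoc, ← mul_assoc, Matrix.trace_mul_comm]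
    rw [this, Matrix.trace]
    simp [hy, dg, Matrix.diagonal_mul]
  have htr2 : ∀ b : Fin n → ℝ, (∀ i, 0 < b i) → (mpow (R * dg b * R) s).trace.re
      = ∑ i, b i * y b i := by
    intro b hb
    rw [← htr]
    nth_rewrite 3 [← mpow_one (hX b hb).posSemidef]
    rw [mpow_add (hX b hb), sub_add_cancel]
  have key := scalar_main s hs0 hs1 y (fun i => (mpow B s i i).re) ?_ ?_ ?_ ?_ a ha0 g hg hga
  · refine key.trans (le_of_eq ?_)
    refine Finset.sum_congr rfl fun i _ => ?_
    congr 1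
    set S := dg (fun i => a i ^ (1/2:ℝ)) with hS
    have hSS : S * S = dg a := by
      rw [hS]; unfold dg
      rw [Matrix.diagonal_mul_diagonal]
      congr 1; ext i
      rw [← Complex.ofReal_mul, ← Real.rpow_add (ha0 i), add_halves, Real.rpow_one]
    have hSH : star S = S := (dg_psd (fun i => (Real.rpow_pos_of_pos (ha0 i) _).le)).isHermitian
    have e1 : R * dg a * R = (R * S) * (S * R) := by rw [← hSS]; simp only [mul_assoc]
    have e2 : S * B * S = (S * R) * (R * S) := by rw [← hRR]; simp only [mul_assoc]
    have hSBS : (S * B * S).PosDef := by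
      have hSu : IsUnit S := (dg_pd (fun i => (Real.rpow_pos_of_pos (ha0 i) _))).isUnit
      have := hB.conjTranspose_mul_mul_same (Matrix.mulVec_injective_of_isUnit hSu)
      rwa [show S.conjTranspose = S from hSH] at this
    have h := intertwine (fun x => x ^ (s-1)) (S * R) (R * S)
      (by rw [← e2]; exact hSBS.isHermitian) (by rw [← e1]; exact (hX a ha0).isHermitian)
    rw [← e1, ← e2] at h
    change S * R * mpow _ _ = mpow _ _ * _ at h
    have e3 : mpow (S * B * S) s = S * (R * mpow (R * dg a * R) (s - 1) * R) * S := by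
      calc mpow (S * B * S) s = mpow (S * B * S) (s - 1) * (S * B * S) := by
            nth_rewrite 3 [← mpow_one hSBS.posSemidef]
            rw [mpow_add hSBS, sub_add_cancel]
        _ = mpow (S * B * S) (s - 1) * (S * R) * (R * S) := by
            nth_rewrite 2 [e2]; simp only [mul_assoc]
        _ = _ := by rw [← h]; simp only [mul_assoc]
    rw [e3, hS]
    simp only [hy]
    unfold dg
    rw [Matrix.mul_diagonal, Matrix.diagonal_mul, mul_right_comm, ← Complex.ofReal_mul,
      ← Real.rpow_add (ha0 i), add_halves, Real.rpow_one, Complex.re_ofReal_mul]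
  · intro i
    have := diag_re_mono (mpow_psd hB.posSemidef s).nonneg i
    simpa using this
  · intro b b' hb hbb i
    apply diag_re_mono
    apply hmono
    apply mpow_antitone _ _ (hX b hb) _ _ (by linarith) (by linarith)
    apply hmono
    rw [Matrix.le_iff]
    have : dg b' - dg b = dg (fun i => b' i - b i) := by
      unfold dg; rw [Matrix.diagonal_sub]; congr 1; ext i; simp
    rw [this]
    exact dg_psd fun i => sub_nonneg.2 (hbb i)
  · intro T hT i
    have e : dg (fun _ : Fin n => T) = T • (1 : Matrix (Fin n) (Fin n) ℂ) := by
      unfold dg; ext i j; by_cases h : i = j <;> simp [h]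
    simp only [hy]
    rw [e, mul_smul_comm, mul_one, smul_mul_assoc, hRR, mpow_smul hB.posSemidef T hT,
      mul_smul_comm, smul_mul_assoc, hR, mpow_add hB, mpow_add hB]
    rw [show (1/2 + (s-1) + 1/2 : ℝ) = s by ring]
    simp
  · intro b b' hb hb'
    rw [← htr2 b hb, ← htr2 b' hb', ← htr b b']
    exact klein (hX b hb) (hX b' hb') s hs0 hs1

open scoped Matrix.Norms.L2Operator in
lemma mpow_tendsto {n : ℕ} (F : ℝ → Matrix (Fin n) (Fin n) ℂ) (hF : Continuous F)
    (hFH : ∀ x, (F x).IsHermitian) (s : ℝ) (hs : 0 ≤ s) (i : Fin n) :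
    Filter.Tendsto (fun x => (mpow (F x) s i i).re) (nhdsWithin 0 (Set.Ioi 0))
      (nhds (mpow (F 0) s i i).re) := by
  have h0 : Filter.Tendsto F (nhdsWithin 0 (Set.Ioi 0)) (nhds (F 0)) :=
    (hF.tendsto 0).mono_left nhdsWithin_le_nhds
  set K := (‖F 0‖ + 1) * ‖(1 : Matrix (Fin n) (Fin n) ℂ)‖
  have hsub : ∀ M : Matrix (Fin n) (Fin n) ℂ, ‖M‖ ≤ ‖F 0‖ + 1 →
      spectrum ℝ M ⊆ Metric.closedBall 0 K := by
    intro M hM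
    refine (spectrum.subset_closedBall_norm_mul M).trans (Metric.closedBall_subset_closedBall ?_)
    exact mul_le_mul_of_nonneg_right hM (norm_nonneg _)
  have hev : ∀ᶠ x in nhdsWithin 0 (Set.Ioi 0), ‖F x‖ ≤ ‖F 0‖ + 1 :=
    (h0.norm.eventually (gt_mem_nhds (lt_add_one _))).mono fun x hx => le_of_lt hx
  have h := Filter.Tendsto.cfc (p := IsSelfAdjoint) (isCompact_closedBall (0 : ℝ) K)
    (fun x : ℝ => x ^ s) h0 (hev.mono fun x hx => hsub _ hx)
    (Filter.Eventually.of_forall fun x => hFH x) (hsub _ (by linarith)) (hFH 0)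
    (Real.continuous_rpow_const hs).continuousOn
  have hc : Continuous (fun M : Matrix (Fin n) (Fin n) ℂ => (M i i).re) :=
    Complex.continuous_re.comp (continuous_id.matrix_elem i i)
  exact (hc.tendsto _).comp h

lemma core2 {n : ℕ} {B : Matrix (Fin n) (Fin n) ℂ} (hB : B.PosSemidef)
    (s : ℝ) (hs0 : 0 < s) (hs1 : s < 1) (a : Fin n → ℝ) (ha0 : ∀ i, 0 ≤ a i)
    (g : Fin n → ℝ) (hg : ∀ i, 0 ≤ g i) (hga : ∀ i j, a i ≤ a j → g i ≤ g j) :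
    ∑ i, g i * (a i ^ s * (mpow B s i i).re) ≤
      ∑ i, g i * (mpow (dg (fun i => a i ^ (1/2:ℝ)) * B * dg (fun i => a i ^ (1/2:ℝ))) s i i).re := by
  have hrH : ∀ b : Fin n → ℝ, (dg b).conjTranspose = dg b := by
    intro b
    unfold dg
    rw [Matrix.diagonal_conjTranspose]
    congr 1; ext i; simp
  set F : ℝ → Matrix (Fin n) (Fin n) ℂ := fun e => B + ((e : ℝ) : ℂ) • (1 : Matrix (Fin n) (Fin n) ℂ) with hF
  set G : ℝ → Matrix (Fin n) (Fin n) ℂ := fun e =>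
    dg (fun i => (a i + e) ^ (1/2:ℝ)) * F e * dg (fun i => (a i + e) ^ (1/2:ℝ)) with hG
  have hFc : Continuous F := by
    apply continuous_const.add
    exact Complex.continuous_ofReal.smul continuous_const
  have hdc : Continuous (fun e : ℝ => dg (fun i => (a i + e) ^ (1/2:ℝ))) := by
    unfold dg
    apply Continuous.matrix_diagonal
    refine continuous_pi fun i => Complex.continuous_ofReal.comp ?_
    exact (Real.continuous_rpow_const (by norm_num)).comp (continuous_const.add continuous_id)
  have hGc : Continuous G := (hdc.matrix_mul hFc).matrix_mul hdc
  have hFH : ∀ e, (F e).IsHermitian := by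
    intro e
    have hb : B.conjTranspose = B := hB.isHermitian
    simp [hF, Matrix.IsHermitian, Matrix.conjTranspose_add, Matrix.conjTranspose_smul, hb]
  have hGH : ∀ e, (G e).IsHermitian := by
    intro e
    have := Matrix.isHermitian_conjTranspose_mul_mul (dg (fun i => (a i + e) ^ (1/2:ℝ))) (hFH e)
    rwa [hrH] at this
  have hF0 : F 0 = B := by simp [hF]
  have hG0 : G 0 = dg (fun i => a i ^ (1/2:ℝ)) * B * dg (fun i => a i ^ (1/2:ℝ)) := by
    simp only [hG, hF0, add_zero]
  have t1 : Filter.Tendsto (fun e => ∑ i, g i * ((a i + e) ^ s * (mpow (F e) s i i).re))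
      (nhdsWithin 0 (Set.Ioi 0)) (nhds (∑ i, g i * (a i ^ s * (mpow B s i i).re))) := by
    refine tendsto_finsetSum _ fun i _ => Filter.Tendsto.const_mul _ (Filter.Tendsto.mul ?_ ?_)
    · have hc : Continuous (fun e : ℝ => (a i + e) ^ s) :=
        (Real.continuous_rpow_const hs0.le).comp (continuous_const.add continuous_id)
      have := (hc.tendsto 0).mono_left (nhdsWithin_le_nhds (s := Set.Ioi 0))
      simpa using this
    · have := mpow_tendsto F hFc hFH s hs0.le i
      rwa [hF0] at this
  have t2 : Filter.Tendsto (fun e => ∑ i, g i * (mpow (G e) s i i).re)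
      (nhdsWithin 0 (Set.Ioi 0)) (nhds (∑ i, g i * (mpow (G 0) s i i).re)) := by
    refine tendsto_finsetSum _ fun i _ => Filter.Tendsto.const_mul _ ?_
    exact mpow_tendsto G hGc hGH s hs0.le i
  rw [← hG0]
  refine le_of_tendsto_of_tendsto t1 t2 ?_
  filter_upwards [self_mem_nhdsWithin] with e he
  have he : 0 < e := he
  have hFp : (F e).PosDef := by
    have h1 : (((e : ℝ) : ℂ) • (1 : Matrix (Fin n) (Fin n) ℂ)).PosDef :=
      Matrix.PosDef.one.smul (by exact_mod_cast he)
    exact Matrix.PosDef.posSemidef_add hB h1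
  exact core hFp s hs0 hs1 (fun i => a i + e) (fun i => by have := ha0 i; linarith) g hg
    (fun i j h => hga i j (by simpa using h))

lemma main_aux {n : ℕ} (A B : Matrix (Fin n) (Fin n) ℂ)
    (hA : A.PosSemidef) (hB : B.PosSemidef)
    (J : Set ℝ) (hJA : spectrum ℝ A ⊆ J)
    (f : ℝ → ℝ) (hf0 : ∀ x ∈ J, 0 ≤ f x) (hf1 : MonotoneOn f J)
    (s : ℝ) (hs0 : 0 < s) (hs1 : s < 1) :
    (Matrix.trace (mfun f A * mpow A s * mpow B s)).re ≤
      (Matrix.trace (mfun f A * mpow (mpow A (1/2) * B * mpow A (1/2)) s)).re := by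
  set hH := hA.isHermitian
  set U : Matrix (Fin n) (Fin n) ℂ := (hH.eigenvectorUnitary : Matrix (Fin n) (Fin n) ℂ) with hUdef
  have hU : star U * U = 1 := Unitary.coe_star_mul_self hH.eigenvectorUnitary
  have hU' : U * star U = 1 := Unitary.coe_mul_star_self hH.eigenvectorUnitary
  set x := hH.eigenvalues with hx
  have hxp : ∀ i, 0 ≤ x i := hA.eigenvalues_nonneg
  have hxJ : ∀ i, x i ∈ J := fun i => hJA (hH.eigenvalues_mem_spectrum_real i)
  have hcfc : ∀ g : ℝ → ℝ, cfc g A = U * dg (fun i => g (x i)) * star U := by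
    intro g
    rw [hH.cfc_eq, Matrix.IsHermitian.cfc, Unitary.conjStarAlgAut_apply]
    rfl
  set M := star U * B * U with hM
  have hMp : M.PosSemidef := by
    have := hB.conjTranspose_mul_mul_same U
    exact this
  have hBM : B = U * M * star U := by
    rw [hM]
    calc B = (U * star U) * B * (U * star U) := by rw [hU', one_mul, mul_one]
      _ = _ := by simp only [mul_assoc]
  have cancel : ∀ P Q : Matrix (Fin n) (Fin n) ℂ,
      (U * P * star U) * (U * Q * star U) = U * (P * Q) * star U := by
    intro P Q
    calc _ = U * P * (star U * U) * Q * star U := by simp only [mul_assoc]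
      _ = _ := by rw [hU]; simp only [mul_assoc, mul_one, one_mul]
  have tr : ∀ P : Matrix (Fin n) (Fin n) ℂ, (U * P * star U).trace = P.trace := by
    intro P
    rw [Matrix.trace_mul_comm, ← mul_assoc, hU, one_mul]
  have trd : ∀ (d : Fin n → ℝ) (P : Matrix (Fin n) (Fin n) ℂ),
      (dg d * P).trace.re = ∑ i, d i * (P i i).re := by
    intro d P
    rw [Matrix.trace]
    simp [dg, Matrix.diagonal_mul]
  have hBs : mpow B s = U * mpow M s * star U := by
    unfold mpow
    rw [hBM]
    exact cfc_conj _ U M hU hU' hMp.isHermitian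
  set S := dg (fun i => x i ^ (1/2:ℝ)) with hS
  have hSH : S.conjTranspose = S := (dg_psd (fun i => Real.rpow_nonneg (hxp i) _)).isHermitian
  have hSMS : (S * M * S).PosSemidef := by
    have := hMp.conjTranspose_mul_mul_same S
    rwa [hSH] at this
  have hAh : mpow A (1/2) = U * S * star U := hcfc _
  have hABA : mpow A (1/2) * B * mpow A (1/2) = U * (S * M * S) * star U := by
    rw [hAh]
    nth_rewrite 1 [hBM]
    rw [cancel, cancel]
  have hABAs : mpow (mpow A (1/2) * B * mpow A (1/2)) s = U * mpow (S * M * S) s * star U := by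
    rw [hABA]
    exact cfc_conj _ U _ hU hU' hSMS.isHermitian
  have hdd : dg (fun i => f (x i)) * dg (fun i => x i ^ s) = dg (fun i => f (x i) * x i ^ s) := by
    unfold dg
    rw [Matrix.diagonal_mul_diagonal]
    congr 1; ext i; push_cast; rfl
  rw [hABAs, hBs, show mfun f A = U * dg (fun i => f (x i)) * star U from hcfc f,
    show mpow A s = U * dg (fun i => x i ^ s) * star U from hcfc _, cancel, cancel, cancel, tr, tr,
    hdd, trd, trd]
  have := core2 hMp s hs0 hs1 x hxp (fun i => f (x i)) (fun i => hf0 _ (hxJ i))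
    (fun i j h => hf1 (hxJ i) (hxJ j) h)
  simpa only [mul_assoc] using this

lemma half_half {n : ℕ} {A : Matrix (Fin n) (Fin n) ℂ} (hA : A.PosSemidef) :
    mpow A (1/2) * mpow A (1/2) = A := by
  nth_rewrite 3 [← mpow_one hA]
  unfold mpow
  rw [← cfc_mul _ _ A (cont_spec _ _) (cont_spec _ _)]
  refine cfc_congr fun x hx => ?_
  have h0 := spec_nonneg hA x hx
  simp only [Real.rpow_one, ← Real.sqrt_eq_rpow, Real.mul_self_sqrt h0]

lemma main_full {n : ℕ} (A B : Matrix (Fin n) (Fin n) ℂ)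
    (hA : A.PosSemidef) (hB : B.PosSemidef)
    (J : Set ℝ) (hJA : spectrum ℝ A ⊆ J)
    (f : ℝ → ℝ) (hf0 : ∀ x ∈ J, 0 ≤ f x) (hf1 : MonotoneOn f J)
    (s : ℝ) (hs : s ∈ Set.Icc (0 : ℝ) 1) :
    (Matrix.trace (mfun f A * mpow A s * mpow B s)).re ≤
      (Matrix.trace (mfun f A * mpow (mpow A (1/2) * B * mpow A (1/2)) s)).re := by
  have hHh : (mpow A (1/2)).conjTranspose = mpow A (1/2) := (mpow_psd hA _).isHermitian
  have hC : (mpow A (1/2) * B * mpow A (1/2)).PosSemidef := by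
    have := hB.conjTranspose_mul_mul_same (mpow A (1/2))
    rwa [hHh] at this
  rcases hs.1.eq_or_lt with h | h
  · subst h
    rw [mpow_zero hA, mpow_zero hB, mpow_zero hC, mul_one]
  rcases hs.2.eq_or_lt with h' | h'
  · subst h'
    rw [mpow_one hA, mpow_one hB, mpow_one hC]
    apply le_of_eq
    congr 1
    have hcomm : mfun f A * mpow A (1/2) = mpow A (1/2) * mfun f A := cfc_commute_cfc _ _ A
    calc (mfun f A * A * B).trace = (mfun f A * (mpow A (1/2) * mpow A (1/2)) * B).trace := by
          rw [half_half hA]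
      _ = (mpow A (1/2) * (mfun f A * mpow A (1/2) * B)).trace := by
          rw [← mul_assoc (mfun f A), congrArg (· * mpow A (1/2)) hcomm]; simp only [mul_assoc]
      _ = _ := by rw [Matrix.trace_mul_comm]; simp only [mul_assoc]
  exact main_aux A B hA hB J hJA f hf0 hf1 s h h'

end
end TrAux

/-- For `A, B` positive semidefinite and `f` nonnegative and nondecreasing on an interval `J`
containing the spectrum of `A`, and `s ∈ [0,1]`:
`Tr[f(A) A^s B^s] ≤ Tr[f(A) (A^{1/2} B A^{1/2})^s]` (as real parts of the traces). -/
theorem stmt_0 {n : ℕ} (A B : Matrix (Fin n) (Fin n) ℂ)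
    (hA : A.PosSemidef) (hB : B.PosSemidef)
    (J : Set ℝ) (hJ : J.OrdConnected) (hJA : spectrum ℝ A ⊆ J)
    (f : ℝ → ℝ) (hf0 : ∀ x ∈ J, 0 ≤ f x) (hf1 : MonotoneOn f J)
    (s : ℝ) (hs : s ∈ Set.Icc (0 : ℝ) 1) :
    (Matrix.trace (mfun f A * mpow A s * mpow B s)).re ≤
      (Matrix.trace (mfun f A * mpow (mpow A (1/2) * B * mpow A (1/2)) s)).re := by
  exact TrAux.main_full A B hA hB J hJA f hf0 hf1 s hs
end

section
/- Let A be an n×n complex positive semidefinite matrix with spectral decomposition A = Σ_{i=1}^n λ_i P_i where λ_1 ≥ λ_2 ≥ ⋯ ≥ λ_n ≥ 0 (each P_i a rank-one orthogonal eigenprojection, or more generally pairwise orthogonal eigenprojections summing to the identity), and set Π_k := Σ_{i=1}^k P_i for 1 ≤ k ≤ n. Then for every n×n complex positive semidefinite matrix B, every s ∈ [0,1], and every 1 ≤ k ≤ n: Tr[Π_k · A^s · B^s] ≤ Tr[Π_k · (A^{1/2} B A^{1/2})^s]. -/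
open scoped ComplexOrder

section Helpers

open scoped MatrixOrder Matrix.Norms.L2Operator Matrix

lemma exists_poly_eq (F : Set ℝ) (hF : F.Finite) (f : ℝ → ℝ) :
    ∃ p : Polynomial ℝ, ∀ x ∈ F, p.eval x = f x := by
  classical
  refine ⟨Lagrange.interpolate hF.toFinset id f, fun x hx => ?_⟩
  exact Lagrange.eval_interpolate_at_node (v := id) f (Function.injective_id.injOn)
    (hF.mem_toFinset.2 hx)

lemma cfc_eq_aeval {m : ℕ} {X : Matrix (Fin m) (Fin m) ℂ} (hX : X.IsHermitian) (f : ℝ → ℝ)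
    (p : Polynomial ℝ) (h : ∀ x ∈ spectrum ℝ X, p.eval x = f x) :
    cfc f X = Polynomial.aeval X p := by
  have hX' : IsSelfAdjoint X := hX
  rw [← cfc_polynomial p X]
  exact cfc_congr fun x hx => (h x hx).symm

lemma mpow_eq_rpow {m : ℕ} {X : Matrix (Fin m) (Fin m) ℂ} (hX : X.PosSemidef) (s : ℝ) :
    mpow X s = X ^ s := by
  rw [mpow, CFC.rpow_eq_cfc_real (Matrix.nonneg_iff_posSemidef.2 hX)]

lemma mpow_herm {m : ℕ} (X : Matrix (Fin m) (Fin m) ℂ) (s : ℝ) : (mpow X s).IsHermitian :=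
  cfc_predicate _ X

lemma mpow_posDef {m : ℕ} {X : Matrix (Fin m) (Fin m) ℂ} (hX : X.PosDef) (s : ℝ) :
    (mpow X s).PosDef := by
  rw [mpow_eq_rpow hX.posSemidef, ← Matrix.isStrictlyPositive_iff_posDef]
  exact IsStrictlyPositive.rpow X s (Matrix.isStrictlyPositive_iff_posDef.2 hX)

lemma mpow_posSemidef {m : ℕ} {X : Matrix (Fin m) (Fin m) ℂ} (hX : X.PosSemidef) (s : ℝ) :
    (mpow X s).PosSemidef := by
  rw [mpow_eq_rpow hX, ← Matrix.nonneg_iff_posSemidef]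
  exact CFC.rpow_nonneg

lemma mpow_add {m : ℕ} {X : Matrix (Fin m) (Fin m) ℂ} (hX : X.PosDef) (s t : ℝ) :
    mpow X (s + t) = mpow X s * mpow X t := by
  simp only [mpow_eq_rpow hX.posSemidef]
  exact CFC.rpow_add hX.isUnit

lemma mpow_one {m : ℕ} {X : Matrix (Fin m) (Fin m) ℂ} (hX : X.PosSemidef) :
    mpow X 1 = X := by
  rw [mpow_eq_rpow hX]
  exact CFC.rpow_one X (Matrix.nonneg_iff_posSemidef.2 hX)

lemma mpow_zero {m : ℕ} {X : Matrix (Fin m) (Fin m) ℂ} (hX : X.PosSemidef) :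
    mpow X 0 = 1 := by
  rw [mpow_eq_rpow hX]
  exact CFC.rpow_zero X (Matrix.nonneg_iff_posSemidef.2 hX)

lemma mpow_smul {m : ℕ} {X : Matrix (Fin m) (Fin m) ℂ} (hX : X.PosSemidef) {r : ℝ}
    (hr : 0 ≤ r) (s : ℝ) : mpow (r • X) s = (r ^ s) • mpow X s := by
  have hX' : IsSelfAdjoint X := hX.1
  have hfin : (spectrum ℝ X).Finite := Matrix.finite_real_spectrum
  unfold mpow
  rw [← cfc_comp_smul r _ X ((hfin.image _).continuousOn _), ← cfc_smul _ _ _ (hfin.continuousOn _)]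
  apply cfc_congr
  intro x hx
  have hx0 : 0 ≤ x := spectrum_nonneg_of_nonneg (Matrix.nonneg_iff_posSemidef.2 hX) hx
  simp [Real.mul_rpow hr hx0]

lemma mpow_anti {m : ℕ} {W X : Matrix (Fin m) (Fin m) ℂ} (hW : W.PosDef)
    (hWX : W ≤ X) {p : ℝ} (hp : p ∈ Set.Icc (-1 : ℝ) 0) :
    mpow X p ≤ mpow W p := by
  have hW' : IsStrictlyPositive W := Matrix.isStrictlyPositive_iff_posDef.2 hW
  have hX' : IsStrictlyPositive X := hW'.of_le hWX
  have hX := Matrix.isStrictlyPositive_iff_posDef.1 hX'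
  have h1 : W ^ (-p) ≤ X ^ (-p) := CFC.rpow_le_rpow ⟨by linarith [hp.2], by linarith [hp.1]⟩ hWX
  have h2 := CStarAlgebra.rpow_neg_one_le_rpow_neg_one h1 (IsStrictlyPositive.rpow W _ hW')
  rw [mpow_eq_rpow hX.posSemidef, mpow_eq_rpow hW.posSemidef]
  by_cases hp0 : p = 0
  · subst hp0
    rw [CFC.rpow_zero X hX'.nonneg, CFC.rpow_zero W hW'.nonneg]
  have e : ∀ Y : Matrix (Fin m) (Fin m) ℂ, IsStrictlyPositive Y → (Y ^ (-p)) ^ (-1 : ℝ) = Y ^ p := by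
    intro Y hY
    rw [CFC.rpow_rpow Y (-p) (-1) (by simpa using hp0) hY]
    simp
  rwa [e X hX', e W hW'] at h2

lemma mul_aeval_comm {m : ℕ} (T S : Matrix (Fin m) (Fin m) ℂ) (p : Polynomial ℝ) :
    T * Polynomial.aeval (S * T) p = Polynomial.aeval (T * S) p * T := by
  induction p using Polynomial.induction_on' with
  | add p q hp hq => simp [mul_add, add_mul, hp, hq]
  | monomial k a =>
    simp only [Polynomial.aeval_monomial, ← Algebra.smul_def, Matrix.mul_smul, Matrix.smul_mul]
    congr 1
    induction k with
    | zero => simp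
    | succ k ih => rw [pow_succ, ← mul_assoc, ih, pow_succ]; simp only [mul_assoc]

lemma mpow_T {m : ℕ} (T : Matrix (Fin m) (Fin m) ℂ) (s : ℝ) :
    T * mpow (Tᴴ * T) s = mpow (T * Tᴴ) s * T := by
  obtain ⟨p, hp⟩ := exists_poly_eq (spectrum ℝ (Tᴴ * T) ∪ spectrum ℝ (T * Tᴴ))
    (Matrix.finite_real_spectrum.union Matrix.finite_real_spectrum) (fun x => x ^ s)
  unfold mpow
  rw [cfc_eq_aeval (Matrix.isHermitian_conjTranspose_mul_self T) _ p fun x hx => hp x (Or.inl hx),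
    cfc_eq_aeval (Matrix.isHermitian_mul_conjTranspose_self T) _ p fun x hx => hp x (Or.inr hx)]
  exact mul_aeval_comm T Tᴴ p

lemma trace_mpow_T {m : ℕ} (T : Matrix (Fin m) (Fin m) ℂ) (hT : IsUnit T) (s : ℝ) :
    (mpow (Tᴴ * T) s).trace = (mpow (T * Tᴴ) s).trace := by
  obtain ⟨u, hu⟩ := hT
  have h := mpow_T T s
  have hu1 : (↑u⁻¹ : Matrix (Fin m) (Fin m) ℂ) * T = 1 := by rw [← hu]; simp
  have hu2 : T * (↑u⁻¹ : Matrix (Fin m) (Fin m) ℂ) = 1 := by rw [← hu]; simp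
  have : mpow (Tᴴ * T) s = (↑u⁻¹ : Matrix (Fin m) (Fin m) ℂ) * (mpow (T * Tᴴ) s * T) := by
    rw [← h, ← mul_assoc, hu1, one_mul]
  rw [this, Matrix.trace_mul_comm, mul_assoc, hu2, mul_one]

/-- Hansen type inequality. -/
lemma hansen {m : ℕ} {X K : Matrix (Fin m) (Fin m) ℂ} (hX : X.PosDef) (hK : K.IsHermitian)
    (hKu : IsUnit K) {r : ℝ} (hr : 0 < r) (hKr : K * K ≤ r • (1 : Matrix (Fin m) (Fin m) ℂ))
    {s : ℝ} (hs : s ∈ Set.Icc (0 : ℝ) 1) :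
    (r ^ (s - 1)) • (K * mpow X s * K) ≤ mpow (K * X * K) s := by
  set R := mpow X (1/2) with hR
  have hRR : R * R = X := by
    rw [hR, ← mpow_add hX]; norm_num; exact mpow_one hX.posSemidef
  have hRh : Rᴴ = R := mpow_herm X _
  have hRu : IsUnit R := (mpow_posDef hX _).isUnit
  set T := R * K with hTdef
  have hTh : Tᴴ = K * R := by rw [hTdef, Matrix.conjTranspose_mul, hRh, hK.eq]
  have hTT : Tᴴ * T = K * X * K := by rw [hTh, hTdef, ← hRR]; simp only [mul_assoc]
  have hTu : IsUnit T := hRu.mul hKu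
  have hTT2 : T * Tᴴ = R * (K * K) * R := by rw [hTh, hTdef]; simp only [mul_assoc]
  have hpd1 : (Tᴴ * T).PosDef := by
    rw [← Matrix.isStrictlyPositive_iff_posDef]
    refine ⟨Matrix.nonneg_iff_posSemidef.2 (Matrix.posSemidef_conjTranspose_mul_self T), ?_⟩
    rw [hTh]; exact (hKu.mul hRu).mul hTu
  have hpd2 : (T * Tᴴ).PosDef := by
    rw [← Matrix.isStrictlyPositive_iff_posDef]
    refine ⟨Matrix.nonneg_iff_posSemidef.2 (Matrix.posSemidef_self_mul_conjTranspose T), ?_⟩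
    rw [hTh]; exact hTu.mul (hKu.mul hRu)
  have hle : T * Tᴴ ≤ r • X := by
    have := star_left_conjugate_le_conjugate hKr R
    rw [Matrix.star_eq_conjTranspose, hRh] at this
    rw [hTT2]
    refine this.trans (le_of_eq ?_)
    simp [hRR]
  have h1 := mpow_anti hpd2 hle (p := s - 1) ⟨by linarith [hs.1], by linarith [hs.2]⟩
  rw [mpow_smul hX.posSemidef hr.le] at h1
  have h2 := star_left_conjugate_le_conjugate h1 T
  rw [Matrix.star_eq_conjTranspose, mul_assoc Tᴴ (mpow (T * Tᴴ) _), ← mpow_T, ← mul_assoc Tᴴ T (mpow (Tᴴ * T) _)] at h2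
  have e1 : Tᴴ * T * mpow (Tᴴ * T) (s - 1) = mpow (Tᴴ * T) s := by
    nth_rw 1 [← mpow_one hpd1.posSemidef]
    rw [← mpow_add hpd1]; congr 1; ring
  have e2 : R * mpow X (s - 1) * R = mpow X s := by
    rw [hR, ← mpow_add hX, ← mpow_add hX]; congr 1; ring
  rw [e1, hTT] at h2
  refine le_trans (le_of_eq ?_) h2
  rw [hTh, hTdef, ← e2]
  simp only [Matrix.mul_smul, Matrix.smul_mul, mul_assoc]

lemma real_step {s K c : ℝ} (hs : s ∈ Set.Icc (0 : ℝ) 1) (hK : 0 ≤ K) (hc : 1 ≤ c) (g : ℝ → ℝ)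
    (hg : ∀ r r', 1 ≤ r → r ≤ r' → r' ≤ c → s * (1 - r / r') * (r' ^ s * K) ≤ g r' - g r) :
    K * (c ^ s - 1) ≤ g c - g 1 := by
  have conc : ∀ x y : ℝ, 1 ≤ x → x ≤ y → y ^ s - x ^ s ≤ s * x ^ (s - 1) * (y - x) := by
    intro x y hx hxy
    have hx0 : 0 < x := by linarith
    have h := rpow_one_add_le_one_add_mul_self (s := y / x - 1) (p := s)
      (by have : 0 ≤ y / x := div_nonneg (by linarith) hx0.le
          linarith) hs.1 hs.2
    have e : 1 + (y / x - 1) = y / x := by ring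
    rw [e, Real.div_rpow (by linarith) hx0.le, div_le_iff₀ (by positivity)] at h
    rw [Real.rpow_sub_one hx0.ne']
    have : (1 + s * (y / x - 1)) * x ^ s = x ^ s + s * (x ^ s / x) * (y - x) := by
      field_simp
    linarith
  have key : ∀ N : ℕ, 0 < N → K * ((c + (c - 1) / N) ^ s - (1 + (c - 1) / N) ^ s) ≤ g c - g 1 := by
    intro N hN
    have hN' : (0 : ℝ) < N := by exact_mod_cast hN
    set δ := (c - 1) / N with hδ
    have hδ0 : 0 ≤ δ := div_nonneg (by linarith) hN'.le
    have hNδ : N * δ = c - 1 := by rw [hδ]; field_simp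
    have ind : ∀ i : ℕ, i ≤ N → K * ((1 + i * δ + δ) ^ s - (1 + δ) ^ s) ≤ g (1 + i * δ) - g 1 := by
      intro i
      induction i with
      | zero => intro _; simp
      | succ i ih =>
        intro hi
        have ih' := ih (by omega)
        have hi' : ((i + 1 : ℕ) : ℝ) ≤ N := by exact_mod_cast hi
        have hid : 0 ≤ (i : ℝ) * δ := by positivity
        have hle : ((i + 1 : ℕ) : ℝ) * δ ≤ c - 1 := by
          rw [← hNδ]; exact mul_le_mul_of_nonneg_right hi' hδ0
        push_cast at hle ⊢
        have h1 := hg (1 + i * δ) (1 + (i + 1) * δ) (by linarith) (by linarith) (by linarith)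
        have h2 := conc (1 + (i + 1) * δ) (1 + (i + 1) * δ + δ) (by linarith) (by linarith)
        have hpos : 0 < 1 + ((i : ℝ) + 1) * δ := by linarith
        have e : s * (1 - (1 + i * δ) / (1 + (i + 1) * δ)) * ((1 + (i + 1) * δ) ^ s * K)
            = K * (s * (1 + (i + 1) * δ) ^ (s - 1) * (1 + (i + 1) * δ + δ - (1 + (i + 1) * δ))) := by
          rw [Real.rpow_sub_one hpos.ne']
          field_simp
          ring
        have h3 := mul_le_mul_of_nonneg_left h2 hK
        have e2 : 1 + (i : ℝ) * δ + δ = 1 + (i + 1) * δ := by ring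
        rw [e2] at ih'
        linarith
    have := ind N le_rfl
    rw [hNδ] at this
    have e : 1 + (c - 1) = c := by ring
    rwa [e] at this
  have lim0 : Filter.Tendsto (fun N : ℕ => (c - 1) / (N : ℝ)) Filter.atTop (nhds 0) :=
    tendsto_const_div_atTop_nhds_zero_nat _
  have hl : ∀ x : ℝ, 1 ≤ x → Filter.Tendsto (fun N : ℕ => (x + (c - 1) / (N : ℝ)) ^ s) Filter.atTop
      (nhds (x ^ s)) := by
    intro x hx
    have h := (tendsto_const_nhds (x := x)).add lim0
    rw [add_zero] at h
    exact h.rpow_const (Or.inl (by linarith))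
  have hlim := ((hl c hc).sub (hl 1 le_rfl)).const_mul K
  rw [Real.one_rpow] at hlim
  refine le_of_tendsto hlim ?_
  filter_upwards [Filter.eventually_gt_atTop 0] with N hN using key N hN

lemma abstract_main {n : ℕ} {s : ℝ} (hs : s ∈ Set.Icc (0 : ℝ) 1)
    (x : (Fin n → ℝ) → Fin n → ℝ)
    (hx0 : ∀ a, (∀ i, 0 < a i) → ∀ i, 0 ≤ x a i)
    (H1 : ∀ a e : Fin n → ℝ, (∀ i, 0 < a i) → (∀ i, 0 < e i) → ∀ r, (∀ i, e i ≤ r) → 0 < r →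
      ∀ i, r ^ (s - 1) * (e i * x a i) ≤ x (e * a) i)
    (Kl : ∀ a e : Fin n → ℝ, (∀ i, 0 < a i) → (∀ i, 0 < e i) →
      ∑ i, x (e * a) i ≤ (1 - s) * ∑ i, x a i + s * ∑ i, e i * x a i)
    (a : Fin n → ℝ) (ha : Antitone a) (ha0 : ∀ i, 0 < a i) (k : Fin n) :
    ∑ i ∈ Finset.Iic k, (a i) ^ s * x 1 i ≤ ∑ i ∈ Finset.Iic k, x a i := by
  classical
  have hb0 : ∀ i, 0 ≤ x 1 i := hx0 1 (fun i => by simp)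
  have compare : ∀ (a : Fin n → ℝ) (S : Finset (Fin n)), (∀ i, 1 ≤ a i) → (∀ i ∉ S, a i = 1) →
      ∑ i, (a i) ^ s * x 1 i ≤ ∑ i, x a i →
      ∑ i ∈ S, (a i) ^ s * x 1 i ≤ ∑ i ∈ S, x a i := by
    intro a S h1 hS h
    have hpos : ∀ i, 0 < a i := fun i => by linarith [h1 i]
    have hc : ∑ i ∈ Sᶜ, x a i ≤ ∑ i ∈ Sᶜ, (a i) ^ s * x 1 i := by
      refine Finset.sum_le_sum fun i hi => ?_
      have hi' := hS i (by simpa using hi)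
      have := H1 a a⁻¹ hpos (fun i => by simpa using hpos i) 1
        (fun i => by simpa using inv_le_one_of_one_le₀ (h1 i)) one_pos i
      have e : a⁻¹ * a = 1 := by
        ext j; simp [(hpos j).ne']
      rw [e] at this
      simpa [hi'] using this
    rw [← Finset.sum_add_sum_compl S, ← Finset.sum_add_sum_compl S (fun i => x a i)] at h
    linarith
  have alt : ∀ (j : ℕ) (a : Fin n → ℝ), Antitone a → (∀ i, 1 ≤ a i) →
      (∀ i : Fin n, j ≤ i.val → a i = 1) → ∑ i, (a i) ^ s * x 1 i ≤ ∑ i, x a i := by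
    intro j
    induction j with
    | zero =>
      intro a _ _ h
      have : a = 1 := by ext i; simpa using h i (Nat.zero_le _)
      subst this
      simp
    | succ j ih =>
      intro a hanti h1 h
      by_cases hj : n ≤ j
      · exact ih a hanti h1 (fun i hi => absurd i.isLt (by omega))
      push Not at hj
      set J : Fin n := ⟨j, hj⟩ with hJ
      set c := a J with hc
      have hc1 : 1 ≤ c := h1 J
      have hc0 : 0 < c := by linarith
      have hgt : ∀ i, ¬ i ≤ J → a i = 1 := by
        intro i hi
        apply h
        have : J.val < i.val := by simpa using hi
        simp only [hJ] at this
        omega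
      set a' : Fin n → ℝ := fun i => if i ≤ J then a i / c else 1 with ha'
      set d : ℝ → Fin n → ℝ := fun r i => if i ≤ J then r else 1 with hd
      have ha'1 : ∀ i, 1 ≤ a' i := by
        intro i
        by_cases hi : i ≤ J
        · simp only [ha', hi, if_true]
          rw [le_div_iff₀ hc0, one_mul]
          exact hanti hi
        · simp [ha', hi]
      have ha'pos : ∀ i, 0 < a' i := fun i => by linarith [ha'1 i]
      have ha'anti : Antitone a' := by
        intro p q hpq
        by_cases hq : q ≤ J
        · have hp : p ≤ J := hpq.trans hq
          simp only [ha', hp, hq, if_true]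
          exact div_le_div_of_nonneg_right (hanti hpq) hc0.le
        · have : a' q = 1 := by simp [ha', hq]
          rw [this]; exact ha'1 p
      have ha'j : ∀ i : Fin n, j ≤ i.val → a' i = 1 := by
        intro i hi
        by_cases hiJ : i ≤ J
        · have : i = J := le_antisymm hiJ (by rw [hJ, Fin.le_def]; exact hi)
          simp [ha', this, ← hc, hc0.ne']
        · simp [ha', hiJ]
      have halt' := ih a' ha'anti ha'1 ha'j
      have hcmp := compare a' (Finset.Iic J) ha'1
        (fun i hi => by simp only [Finset.mem_Iic] at hi; simp [ha', hi]) halt'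
      set K := ∑ i ∈ Finset.Iic J, (a' i) ^ s * x 1 i with hK
      have hK0 : 0 ≤ K := Finset.sum_nonneg fun i _ =>
        mul_nonneg (Real.rpow_nonneg (ha'pos i).le _) (hb0 i)
      have hdpos : ∀ r, 0 < r → ∀ i, 0 < d r i := by
        intro r hr i
        by_cases hi : i ≤ J <;> simp [hd, hi, hr]
      have hda : ∀ r, 0 < r → ∀ i, 0 < (d r * a') i := fun r hr i =>
        mul_pos (hdpos r hr i) (ha'pos i)
      have hstep := real_step hs hK0 hc1 (fun r => ∑ i, x (d r * a') i) (by
        intro r r' hr hrr' _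
        have hr0 : 0 < r := by linarith
        have hr'0 : 0 < r' := by linarith
        have hq : 0 < r / r' := by positivity
        have k1 := Kl (d r' * a') (d (r / r')) (hda r' hr'0) (hdpos _ hq)
        have e1 : d (r / r') * (d r' * a') = d r * a' := by
          rw [← mul_assoc]
          congr 1
          ext i
          by_cases hi : i ≤ J <;> simp [hd, hi, hr'0.ne']
        rw [e1] at k1
        have e2 : ∑ i, d (r / r') i * x (d r' * a') i = ∑ i, x (d r' * a') i
            - (1 - r / r') * ∑ i ∈ Finset.Iic J, x (d r' * a') i := by
          rw [← Finset.sum_add_sum_compl (Finset.Iic J),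
            ← Finset.sum_add_sum_compl (Finset.Iic J) (fun i => x (d r' * a') i)]
          have f1 : ∑ i ∈ Finset.Iic J, d (r / r') i * x (d r' * a') i
              = r / r' * ∑ i ∈ Finset.Iic J, x (d r' * a') i := by
            rw [Finset.mul_sum]
            refine Finset.sum_congr rfl fun i hi => ?_
            have hi' : i ≤ J := by simpa using hi
            simp [hd, hi']
          have f2 : ∑ i ∈ (Finset.Iic J)ᶜ, d (r / r') i * x (d r' * a') i
              = ∑ i ∈ (Finset.Iic J)ᶜ, x (d r' * a') i := by
            refine Finset.sum_congr rfl fun i hi => ?_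
            have hi' : ¬ i ≤ J := by simpa using hi
            simp [hd, hi']
          rw [f1, f2]; ring
        rw [e2] at k1
        have k2 : r' ^ s * K ≤ ∑ i ∈ Finset.Iic J, x (d r' * a') i := by
          refine (mul_le_mul_of_nonneg_left hcmp (Real.rpow_nonneg hr'0.le s)).trans ?_
          rw [Finset.mul_sum]
          refine Finset.sum_le_sum fun i hi => ?_
          have hi' : i ≤ J := by simpa using hi
          have := H1 a' (d r') ha'pos (hdpos r' hr'0) r' (fun i => by
            by_cases hi : i ≤ J
            · simp [hd, hi]
            · simp only [hd, hi, if_false]; linarith) hr'0 i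
          refine le_trans (le_of_eq ?_) this
          simp only [hd, hi', if_true]
          rw [Real.rpow_sub_one hr'0.ne']
          field_simp
        have hc' : 0 ≤ s * (1 - r / r') := by
          apply mul_nonneg hs.1
          rw [sub_nonneg, div_le_one hr'0]; exact hrr'
        have k3 := mul_le_mul_of_nonneg_left k2 hc'
        show _ ≤ ∑ i, x (d r' * a') i - ∑ i, x (d r * a') i
        linarith)
      have ec : d c * a' = a := by
        ext i
        by_cases hi : i ≤ J
        · simp only [Pi.mul_apply, hd, ha', hi, if_true]; field_simp
        · simp [hd, ha', hi, hgt i hi]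
      have e1 : d 1 * a' = a' := by
        ext i
        simp [hd]
      simp only [ec, e1] at hstep
      have es : ∑ i, (a i) ^ s * x 1 i = ∑ i, (a' i) ^ s * x 1 i + K * (c ^ s - 1) := by
        rw [← Finset.sum_add_sum_compl (Finset.Iic J),
          ← Finset.sum_add_sum_compl (Finset.Iic J) (fun i => (a' i) ^ s * x 1 i), ← hK]
        have f1 : ∑ i ∈ Finset.Iic J, (a i) ^ s * x 1 i = c ^ s * K := by
          rw [hK, Finset.mul_sum]
          refine Finset.sum_congr rfl fun i hi => ?_
          have hi' : i ≤ J := by simpa using hi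
          have : a i = c * a' i := by
            simp only [ha', hi', if_true]; field_simp
          rw [this, Real.mul_rpow hc0.le (ha'pos i).le, mul_assoc]
        have f2 : ∑ i ∈ (Finset.Iic J)ᶜ, (a i) ^ s * x 1 i
            = ∑ i ∈ (Finset.Iic J)ᶜ, (a' i) ^ s * x 1 i := by
          refine Finset.sum_congr rfl fun i hi => ?_
          have hi' : ¬ i ≤ J := by simpa using hi
          simp [ha', hi', hgt i hi']
        rw [f1, f2]; ring
      linarith
  have hμ := ha0 k
  set μ := a k with hμdef
  set a1 : Fin n → ℝ := fun i => max (a i) μ / μ with ha1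
  set e : Fin n → ℝ := fun i => min (a i) μ with he
  have h1 : ∀ i, 1 ≤ a1 i := fun i => by
    simp only [ha1]; rw [le_div_iff₀ hμ, one_mul]; exact le_max_right _ _
  have hanti1 : Antitone a1 := fun p q hpq =>
    div_le_div_of_nonneg_right (max_le_max (ha hpq) le_rfl) hμ.le
  have hA := alt n a1 hanti1 h1 (fun i hi => absurd i.isLt (by omega))
  have hcmp := compare a1 (Finset.Iic k) h1 (fun i hi => by
    have hi' : k ≤ i := by
      simp only [Finset.mem_Iic, not_le] at hi; exact hi.le
    have : a i ≤ μ := ha hi'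
    simp [ha1, max_eq_right this, hμ.ne']) hA
  have ee : e * a1 = a := by
    ext i
    simp only [Pi.mul_apply, he, ha1]
    rw [← mul_div_assoc, min_mul_max]
    field_simp
  refine le_trans (le_of_eq ?_) ((mul_le_mul_of_nonneg_left hcmp
    (Real.rpow_nonneg hμ.le s)).trans ?_)
  · rw [Finset.mul_sum]
    refine Finset.sum_congr rfl fun i hi => ?_
    have hi' : i ≤ k := by simpa using hi
    have : μ ≤ a i := ha hi'
    simp only [ha1, max_eq_left this]
    rw [Real.div_rpow (ha0 i).le hμ.le]
    have := Real.rpow_pos_of_pos hμ s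
    field_simp
  · rw [Finset.mul_sum]
    refine Finset.sum_le_sum fun i hi => ?_
    have hi' : i ≤ k := by simpa using hi
    have hle : μ ≤ a i := ha hi'
    have := H1 a1 e (fun i => by linarith [h1 i]) (fun i => lt_min (ha0 i) hμ) μ
      (fun i => min_le_right _ _) hμ i
    rw [ee] at this
    refine le_trans (le_of_eq ?_) this
    simp only [he, min_eq_right hle]
    rw [Real.rpow_sub_one hμ.ne']
    field_simp

lemma trace_cfc_mul_cfc {m : ℕ} {X Y : Matrix (Fin m) (Fin m) ℂ} (hX : X.IsHermitian)
    (hY : Y.IsHermitian) :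
    ∃ w : Fin m → Fin m → ℝ, (∀ i j, 0 ≤ w i j) ∧ ∀ f g : ℝ → ℝ,
      (cfc f X * cfc g Y).trace.re
        = ∑ i, ∑ j, w i j * (f (hX.eigenvalues i) * g (hY.eigenvalues j)) := by
  obtain ⟨U, hU⟩ : ∃ U : Matrix (Fin m) (Fin m) ℂ,
    U = (hX.eigenvectorUnitary : Matrix (Fin m) (Fin m) ℂ) := ⟨_, rfl⟩
  obtain ⟨V, hV⟩ : ∃ V : Matrix (Fin m) (Fin m) ℂ,
    V = (hY.eigenvectorUnitary : Matrix (Fin m) (Fin m) ℂ) := ⟨_, rfl⟩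
  refine ⟨fun i j => Complex.normSq ((star U * V) i j), fun i j => Complex.normSq_nonneg _, ?_⟩
  intro f g
  rw [hX.cfc_eq, hY.cfc_eq, Matrix.IsHermitian.cfc, Matrix.IsHermitian.cfc,
    Unitary.conjStarAlgAut_apply, Unitary.conjStarAlgAut_apply, ← hU, ← hV]
  set W := star U * V with hW
  have hWs : star W = star V * U := by rw [hW, star_mul, star_star]
  set Dx := Matrix.diagonal ((RCLike.ofReal : ℝ → ℂ) ∘ f ∘ hX.eigenvalues)
  set Dy := Matrix.diagonal ((RCLike.ofReal : ℝ → ℂ) ∘ g ∘ hY.eigenvalues)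
  have : (U * Dx * star U * (V * Dy * star V)).trace = (Dx * W * (Dy * star W)).trace := by
    rw [hWs, hW]
    simp only [mul_assoc]
    rw [Matrix.trace_mul_comm U]
    simp only [mul_assoc]
  rw [this]
  simp only [Matrix.trace, Matrix.diag_apply, Complex.re_sum]
  refine Finset.sum_congr rfl fun i _ => ?_
  rw [Matrix.mul_apply, Complex.re_sum]
  refine Finset.sum_congr rfl fun j _ => ?_
  simp only [Dx, Dy, Matrix.diagonal_mul, Matrix.star_apply, Function.comp]
  have : ((f (hX.eigenvalues i) : ℂ) * W i j) * ((g (hY.eigenvalues j) : ℂ) * star (W i j))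
      = ((Complex.normSq (W i j) * (f (hX.eigenvalues i) * g (hY.eigenvalues j)) : ℝ) : ℂ) := by
    push_cast
    rw [Complex.normSq_eq_conj_mul_self]
    simp only [RCLike.star_def]
    ring
  exact (congrArg Complex.re this).trans (Complex.ofReal_re _)

lemma klein {m : ℕ} {K Y : Matrix (Fin m) (Fin m) ℂ} (hY : Y.PosDef) (hK : K.IsHermitian)
    (hKu : IsUnit K) {s : ℝ} (hs : s ∈ Set.Icc (0 : ℝ) 1) :
    (mpow (K * Y * K) s).trace.re ≤
      (1 - s) * (mpow Y s).trace.re + s * (K * K * mpow Y s).trace.re := by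
  set R := mpow Y (1/2) with hR
  have hRR : R * R = Y := by
    rw [hR, ← mpow_add hY]; norm_num; exact mpow_one hY.posSemidef
  have hRh : Rᴴ = R := mpow_herm Y _
  have hRu : IsUnit R := (mpow_posDef hY _).isUnit
  set T := R * K with hTdef
  have hTh : Tᴴ = K * R := by rw [hTdef, Matrix.conjTranspose_mul, hRh, hK.eq]
  have hTT : Tᴴ * T = K * Y * K := by rw [hTh, hTdef, ← hRR]; simp only [mul_assoc]
  have hTu : IsUnit T := hRu.mul hKu
  have hTT2 : T * Tᴴ = R * (K * K) * R := by rw [hTh, hTdef]; simp only [mul_assoc]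
  rw [← hTT, trace_mpow_T T hTu]
  set X := T * Tᴴ with hX
  have hXp : X.PosSemidef := Matrix.posSemidef_self_mul_conjTranspose T
  obtain ⟨w, hw, hsum⟩ := trace_cfc_mul_cfc hXp.1 hY.1
  have t1 := hsum (fun x => x ^ s) (fun _ => 1)
  have t2 := hsum (fun _ => 1) (fun x => x ^ s)
  have t3 := hsum id (fun x => x ^ (s - 1))
  have hXs : IsSelfAdjoint X := hXp.1
  have hYs : IsSelfAdjoint Y := hY.1
  rw [cfc_const_one ℝ Y, mul_one] at t1
  rw [cfc_const_one ℝ X, one_mul] at t2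
  rw [cfc_id ℝ X] at t3
  change (mpow X s).trace.re = _ at t1
  change (mpow Y s).trace.re = _ at t2
  change (X * mpow Y (s - 1)).trace.re = _ at t3
  have e3 : (X * mpow Y (s - 1)).trace = (K * K * mpow Y s).trace := by
    have e2 : R * mpow Y (s - 1) * R = mpow Y s := by
      rw [hR, ← mpow_add hY, ← mpow_add hY]; congr 1; ring
    rw [hTT2, ← e2, mul_assoc, mul_assoc, Matrix.trace_mul_comm]
    simp only [mul_assoc]
  rw [← e3, t1, t2, t3, Finset.mul_sum, Finset.mul_sum, ← Finset.sum_add_distrib]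
  refine Finset.sum_le_sum fun i _ => ?_
  rw [Finset.mul_sum, Finset.mul_sum, ← Finset.sum_add_distrib]
  refine Finset.sum_le_sum fun j _ => ?_
  have hx : 0 ≤ hXp.1.eigenvalues i := hXp.eigenvalues_nonneg i
  have hy : 0 < hY.1.eigenvalues j := hY.eigenvalues_pos j
  set x := hXp.1.eigenvalues i
  set y := hY.1.eigenvalues j
  have young : x ^ s ≤ (1 - s) * y ^ s + s * (x * y ^ (s - 1)) := by
    have h := rpow_one_add_le_one_add_mul_self (s := x / y - 1) (p := s)
      (by have : 0 ≤ x / y := div_nonneg hx hy.le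
          linarith) hs.1 hs.2
    have e : 1 + (x / y - 1) = x / y := by ring
    rw [e, Real.div_rpow hx hy.le, div_le_iff₀ (by positivity)] at h
    rw [Real.rpow_sub_one hy.ne']
    refine h.trans (le_of_eq ?_)
    field_simp
    ring
  have := mul_le_mul_of_nonneg_left young (hw i j)
  simp only [id, mul_one, one_mul]
  linarith

/-- A family of pairwise orthogonal projections summing to one. -/
structure IsPVM {n : ℕ} (P : Fin n → Matrix (Fin n) (Fin n) ℂ) : Prop where
  herm : ∀ i, (P i).IsHermitian
  idem : ∀ i, P i * P i = P i
  orth : ∀ i j, i ≠ j → P i * P j = 0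
  sum : ∑ i, P i = 1

/-- The combination `Σ a_i P_i`. -/
noncomputable def DD {n : ℕ} (P : Fin n → Matrix (Fin n) (Fin n) ℂ) (a : Fin n → ℝ) :
    Matrix (Fin n) (Fin n) ℂ := ∑ i, (a i : ℂ) • P i

section PVM
variable {n : ℕ} {P : Fin n → Matrix (Fin n) (Fin n) ℂ}

lemma P_mul_DD (hP : IsPVM P) (a : Fin n → ℝ) (i : Fin n) : P i * DD P a = (a i : ℂ) • P i := by
  rw [DD, Finset.mul_sum, Finset.sum_eq_single i]
  · rw [Matrix.mul_smul, hP.idem]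
  · intro j _ hj
    rw [Matrix.mul_smul, hP.orth i j hj.symm, smul_zero]
  · simp

lemma DD_mul_P (hP : IsPVM P) (a : Fin n → ℝ) (i : Fin n) : DD P a * P i = (a i : ℂ) • P i := by
  rw [DD, Finset.sum_mul, Finset.sum_eq_single i]
  · rw [Matrix.smul_mul, hP.idem]
  · intro j _ hj
    rw [Matrix.smul_mul, hP.orth j i hj, smul_zero]
  · simp

lemma DD_mul (hP : IsPVM P) (a b : Fin n → ℝ) : DD P a * DD P b = DD P (a * b) := by
  conv_lhs => rw [DD, Finset.sum_mul]
  simp only [Matrix.smul_mul, P_mul_DD hP, smul_smul]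
  simp [DD]

lemma DD_one (hP : IsPVM P) : DD P 1 = 1 := by
  simp [DD, hP.sum]

lemma DD_herm (hP : IsPVM P) (a : Fin n → ℝ) : (DD P a).IsHermitian := by
  rw [Matrix.IsHermitian, DD, Matrix.conjTranspose_sum]
  refine Finset.sum_congr rfl fun i _ => ?_
  rw [Matrix.conjTranspose_smul, (hP.herm i).eq]
  simp

lemma P_psd (hP : IsPVM P) (i : Fin n) : (P i).PosSemidef := by
  have := Matrix.posSemidef_conjTranspose_mul_self (P i)
  rwa [(hP.herm i).eq, hP.idem i] at this

lemma DD_psd (hP : IsPVM P) {a : Fin n → ℝ} (ha : ∀ i, 0 ≤ a i) : (DD P a).PosSemidef := by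
  have h : DD P a = (DD P (fun i => √(a i)))ᴴ * DD P (fun i => √(a i)) := by
    rw [(DD_herm hP _).eq, DD_mul hP]
    congr 1; ext i; simp [Real.mul_self_sqrt (ha i)]
  rw [h]; exact Matrix.posSemidef_conjTranspose_mul_self _

lemma DD_isUnit (hP : IsPVM P) {a : Fin n → ℝ} (ha : ∀ i, a i ≠ 0) : IsUnit (DD P a) := by
  refine IsUnit.of_mul_eq_one (DD P a⁻¹) ?_
  rw [DD_mul hP, ← DD_one hP]
  congr 1; ext i; simp [ha i]

lemma DD_sub (a b : Fin n → ℝ) : DD P a - DD P b = DD P (a - b) := by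
  simp [DD, ← Finset.sum_sub_distrib, sub_smul]

lemma DD_aeval (hP : IsPVM P) (a : Fin n → ℝ) (p : Polynomial ℝ) :
    Polynomial.aeval (DD P a) p = DD P (fun i => p.eval (a i)) := by
  induction p using Polynomial.induction_on' with
  | add p q hp hq =>
    rw [map_add, hp, hq]
    simp only [DD, ← Finset.sum_add_distrib, Polynomial.eval_add, Complex.ofReal_add, add_smul]
  | monomial k c =>
    have hpow : DD P a ^ k = DD P (fun i => a i ^ k) := by
      induction k with
      | zero => simp only [pow_zero]; exact (DD_one hP).symm
      | succ k ih =>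
        rw [pow_succ, ih, DD_mul hP]
        congr 1
    rw [Polynomial.aeval_monomial, ← Algebra.smul_def, hpow]
    simp only [DD, Finset.smul_sum, Polynomial.eval_monomial]
    refine Finset.sum_congr rfl fun i _ => ?_
    rw [Complex.ofReal_mul, mul_smul]
    rfl

lemma DD_mpow (hP : IsPVM P) (a : Fin n → ℝ) (s : ℝ) :
    mpow (DD P a) s = DD P (fun i => a i ^ s) := by
  obtain ⟨p, hp⟩ := exists_poly_eq (spectrum ℝ (DD P a) ∪ Set.range a)
    (Matrix.finite_real_spectrum.union (Set.finite_range a)) (fun x => x ^ s)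
  rw [mpow, cfc_eq_aeval (DD_herm hP a) _ p fun x hx => hp x (Or.inl hx), DD_aeval hP]
  congr 1; ext i
  exact hp _ (Or.inr ⟨i, rfl⟩)

lemma tau_mono (hP : IsPVM P) {M N : Matrix (Fin n) (Fin n) ℂ} (h : M ≤ N) (i : Fin n) :
    (P i * M).trace.re ≤ (P i * N).trace.re := by
  have h1 : ∀ M : Matrix (Fin n) (Fin n) ℂ, (P i * M).trace = ((P i)ᴴ * M * P i).trace := by
    intro M
    rw [Matrix.trace_mul_comm _ (P i), ← mul_assoc, (hP.herm i).eq, hP.idem]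
  have h2 : ((P i)ᴴ * (N - M) * P i).PosSemidef :=
    (Matrix.le_iff.1 h).conjTranspose_mul_mul_same (P i)
  have h3 := h2.trace_nonneg
  rw [← h1, mul_sub, Matrix.trace_sub] at h3
  have := (Complex.le_def.1 h3).1
  simpa using this

lemma conj_posDef {X K : Matrix (Fin n) (Fin n) ℂ} (hX : X.PosDef) (hK : K.IsHermitian)
    (hKu : IsUnit K) : (K * X * K).PosDef := by
  rw [← Matrix.isStrictlyPositive_iff_posDef]
  refine ⟨Matrix.nonneg_iff_posSemidef.2 ?_, (hKu.mul hX.isUnit).mul hKu⟩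
  have := hX.posSemidef.conjTranspose_mul_mul_same K
  rwa [hK.eq] at this

lemma main_posDef (hP : IsPVM P) {B : Matrix (Fin n) (Fin n) ℂ} (hB : B.PosDef)
    (a : Fin n → ℝ) (ha : Antitone a) (ha0 : ∀ i, 0 < a i) (k : Fin n) {s : ℝ}
    (hs : s ∈ Set.Icc (0 : ℝ) 1) :
    (Matrix.trace ((∑ i ∈ Finset.Iic k, P i) * mpow (DD P a) s * mpow B s)).re ≤
      (Matrix.trace ((∑ i ∈ Finset.Iic k, P i) *
        mpow (mpow (DD P a) (1/2) * B * mpow (DD P a) (1/2)) s)).re := by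
  set q : (Fin n → ℝ) → Fin n → ℝ := fun a i => a i ^ (1/2 : ℝ) with hq
  set X : (Fin n → ℝ) → Matrix (Fin n) (Fin n) ℂ := fun a => DD P (q a) * B * DD P (q a) with hX
  have hqpos : ∀ a : Fin n → ℝ, (∀ i, 0 < a i) → ∀ i, 0 < q a i := fun a h i =>
    Real.rpow_pos_of_pos (h i) _
  have hqu : ∀ a : Fin n → ℝ, (∀ i, 0 < a i) → IsUnit (DD P (q a)) := fun a h =>
    DD_isUnit hP fun i => (hqpos a h i).ne'
  have hqq : ∀ a : Fin n → ℝ, (∀ i, 0 < a i) → q a * q a = a := by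
    intro a h
    ext i
    simp only [hq, Pi.mul_apply]
    rw [← Real.rpow_add (h i)]; norm_num
  have hXpd : ∀ a : Fin n → ℝ, (∀ i, 0 < a i) → (X a).PosDef := fun a h =>
    conj_posDef hB (DD_herm hP _) (hqu a h)
  have hXmul : ∀ a e : Fin n → ℝ, (∀ i, 0 < a i) → (∀ i, 0 < e i) →
      X (e * a) = DD P (q e) * X a * DD P (q e) := by
    intro a e ha he
    have : q (e * a) = q e * q a := by
      ext i
      simp only [hq, Pi.mul_apply]
      exact Real.mul_rpow (he i).le (ha i).le
    simp only [hX, this]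
    nth_rw 2 [mul_comm (q e) (q a)]
    rw [← DD_mul hP, ← DD_mul hP]
    simp only [mul_assoc]
  have hX1 : X 1 = B := by
    have : q 1 = 1 := by ext i; simp [hq]
    simp [hX, this, DD_one hP]
  set x : (Fin n → ℝ) → Fin n → ℝ := fun a i => (P i * mpow (X a) s).trace.re with hx
  have trsum : ∀ (b : Fin n → ℝ) (M : Matrix (Fin n) (Fin n) ℂ),
      (DD P b * M).trace.re = ∑ i, b i * (P i * M).trace.re := by
    intro b M
    simp [DD, Finset.sum_mul, Matrix.trace_sum]
  have trone : ∀ (M : Matrix (Fin n) (Fin n) ℂ),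
      M.trace.re = ∑ i, (P i * M).trace.re := by
    intro M
    have := trsum 1 M
    simpa [DD_one hP] using this
  have key := abstract_main hs x ?_ ?_ ?_ a ha ha0 k
  · have eR : (Matrix.trace ((∑ i ∈ Finset.Iic k, P i) *
        mpow (mpow (DD P a) (1/2) * B * mpow (DD P a) (1/2)) s)).re
        = ∑ i ∈ Finset.Iic k, x a i := by
      rw [DD_mpow hP, Finset.sum_mul, Matrix.trace_sum, Complex.re_sum]
    have eL : (Matrix.trace ((∑ i ∈ Finset.Iic k, P i) * mpow (DD P a) s * mpow B s)).re
        = ∑ i ∈ Finset.Iic k, (a i) ^ s * x 1 i := by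
      simp only [hx]
      rw [DD_mpow hP, Finset.sum_mul, Finset.sum_mul, Matrix.trace_sum, Complex.re_sum, hX1]
      refine Finset.sum_congr rfl fun i _ => ?_
      rw [P_mul_DD hP, Matrix.smul_mul, Matrix.trace_smul, smul_eq_mul, Complex.re_ofReal_mul]
    rw [eR, eL]; exact key
  · intro a ha i
    have := tau_mono hP (Matrix.nonneg_iff_posSemidef.2
      (mpow_posSemidef (hXpd a ha).posSemidef s)) i
    simpa using this
  · intro a e ha he r her hr i
    have hK : DD P (q e) * DD P (q e) ≤ r • (1 : Matrix (Fin n) (Fin n) ℂ) := by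
      rw [DD_mul hP, hqq e he]
      have e1 : r • (1 : Matrix (Fin n) (Fin n) ℂ) = DD P (fun _ => r) := by
        rw [← hP.sum, DD, Finset.smul_sum]; rfl
      rw [e1, Matrix.le_iff, DD_sub]
      exact DD_psd hP fun i => by simpa using her i
    have := tau_mono hP (hansen (hXpd a ha) (DD_herm hP _) (hqu e he) hr hK hs) i
    simp only [hx]
    rw [hXmul a e ha he]
    refine le_trans (le_of_eq ?_) this
    have e2 : (P i * (DD P (q e) * mpow (X a) s * DD P (q e))).trace
        = (e i : ℂ) * (P i * mpow (X a) s).trace := by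
      rw [← mul_assoc, ← mul_assoc, P_mul_DD hP, Matrix.trace_mul_comm, Matrix.smul_mul,
        Matrix.mul_smul, ← mul_assoc, DD_mul_P hP, Matrix.smul_mul, smul_smul, Matrix.trace_smul,
        smul_eq_mul, ← Complex.ofReal_mul]
      congr 2
      exact congrFun (hqq e he) i
    rw [Matrix.mul_smul, Matrix.trace_smul, e2, Complex.smul_re, Complex.re_ofReal_mul,
      smul_eq_mul]
  · intro a e ha he
    have := klein (hXpd a ha) (DD_herm hP (q e)) (hqu e he) hs
    rw [← hXmul a e ha he, DD_mul hP, hqq e he, trsum, trone, trone (mpow (X a) s)] at this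
    exact this

end PVM

lemma mpow_tendsto {m : ℕ} {l : Filter ℝ} {M : ℝ → Matrix (Fin m) (Fin m) ℂ}
    {M0 : Matrix (Fin m) (Fin m) ℂ} (hM : ∀ᶠ e in l, (M e).PosSemidef) (hM0 : M0.PosSemidef)
    (h : Filter.Tendsto M l (nhds M0)) {s : ℝ} (hs : 0 < s) :
    Filter.Tendsto (fun e => mpow (M e) s) l (nhds (mpow M0 s)) := by
  obtain ⟨r, hr⟩ : ∃ r : NNReal, (r : ℝ) = s := ⟨⟨s, hs.le⟩, rfl⟩
  subst hr
  have hc := CFC.continuousOn_nnrpow (A := Matrix (Fin m) (Fin m) ℂ) r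
  have h1 := hc M0 (Matrix.nonneg_iff_posSemidef.2 hM0)
  have h2 : Filter.Tendsto M l (nhdsWithin M0 {a | 0 ≤ a}) :=
    tendsto_nhdsWithin_iff.2 ⟨h, hM.mono fun e he => Matrix.nonneg_iff_posSemidef.2 he⟩
  have h3 := h1.tendsto.comp h2
  have e : ∀ N : Matrix (Fin m) (Fin m) ℂ, N.PosSemidef → N ^ r = mpow N r := by
    intro N hN
    rw [mpow_eq_rpow hN]
    exact CFC.nnrpow_eq_rpow (A := Matrix (Fin m) (Fin m) ℂ) (x := r) (by exact_mod_cast hs)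
  rw [e M0 hM0] at h3
  refine h3.congr' ?_
  filter_upwards [hM] with t ht using e _ ht

end Helpers

/-- Proposition 1: with `A = Σ_i λ_i P_i` a spectral decomposition with eigenvalues in
nonincreasing order and `Π_k = Σ_{i ≤ k} P_i`, for all PSD `B` and `s ∈ [0,1]`:
`Tr[Π_k A^s B^s] ≤ Tr[Π_k (A^{1/2} B A^{1/2})^s]`. -/
theorem stmt_1 {n : ℕ} (A B : Matrix (Fin n) (Fin n) ℂ) (hB : B.PosSemidef)
    (lam : Fin n → ℝ) (P : Fin n → Matrix (Fin n) (Fin n) ℂ)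
    (hlam : Antitone lam) (hlam0 : ∀ i, 0 ≤ lam i)
    (hPherm : ∀ i, (P i).IsHermitian)
    (hPidem : ∀ i, P i * P i = P i)
    (hPorth : ∀ i j, i ≠ j → P i * P j = 0)
    (hPsum : ∑ i, P i = 1)
    (hA : A = ∑ i, (lam i : ℂ) • P i)
    (k : Fin n) (s : ℝ) (hs : s ∈ Set.Icc (0 : ℝ) 1) :
    (Matrix.trace ((∑ i ∈ Finset.Iic k, P i) * mpow A s * mpow B s)).re ≤
      (Matrix.trace ((∑ i ∈ Finset.Iic k, P i) *
        mpow (mpow A (1/2) * B * mpow A (1/2)) s)).re := by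
  have hP : IsPVM P := ⟨hPherm, hPidem, hPorth, hPsum⟩
  have hA' : A = DD P lam := hA
  have hApsd : A.PosSemidef := hA' ▸ DD_psd hP hlam0
  have conjpsd : ∀ C D : Matrix (Fin n) (Fin n) ℂ, D.PosSemidef →
      (mpow C (1/2) * D * mpow C (1/2)).PosSemidef := by
    intro C D hD
    have := hD.conjTranspose_mul_mul_same (mpow C (1/2))
    rwa [(mpow_herm C (1/2)).eq] at this
  rcases eq_or_lt_of_le hs.1 with h0 | hs0
  · subst h0
    rw [mpow_zero hApsd, mpow_zero hB, mpow_zero (conjpsd A B hB)]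
    simp
  · set Ae : ℝ → Matrix (Fin n) (Fin n) ℂ := fun e => DD P (fun i => lam i + e) with hAe
    set Be : ℝ → Matrix (Fin n) (Fin n) ℂ := fun e => B + (e : ℂ) • 1 with hBe
    have hpos : ∀ᶠ e : ℝ in nhdsWithin 0 (Set.Ioi 0), 0 < e := self_mem_nhdsWithin
    have tA : Filter.Tendsto Ae (nhdsWithin 0 (Set.Ioi 0)) (nhds A) := by
      have : Continuous Ae := by
        simp only [hAe, DD]
        fun_prop
      have h := this.tendsto 0
      have e : Ae 0 = A := by simp [hAe, hA']
      rw [e] at h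
      exact h.mono_left nhdsWithin_le_nhds
    have tB : Filter.Tendsto Be (nhdsWithin 0 (Set.Ioi 0)) (nhds B) := by
      have : Continuous Be := by
        simp only [hBe]
        fun_prop
      have h := this.tendsto 0
      have e : Be 0 = B := by simp [hBe]
      rw [e] at h
      exact h.mono_left nhdsWithin_le_nhds
    have pB : ∀ e : ℝ, 0 < e → (Be e).PosDef := fun e he =>
      Matrix.PosDef.posSemidef_add hB (Matrix.PosDef.one.smul (by exact_mod_cast he))
    have qA : ∀ᶠ e : ℝ in nhdsWithin 0 (Set.Ioi 0), (Ae e).PosSemidef := by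
      filter_upwards [hpos] with e he
      exact DD_psd hP fun i => by linarith [hlam0 i]
    have qB : ∀ᶠ e : ℝ in nhdsWithin 0 (Set.Ioi 0), (Be e).PosSemidef := by
      filter_upwards [hpos] with e he using (pB e he).posSemidef
    have tAs := mpow_tendsto qA hApsd tA hs0
    have tBs := mpow_tendsto qB hB tB hs0
    have tAh := mpow_tendsto qA hApsd tA (s := 1/2) (by norm_num)
    have tX := mpow_tendsto (qB.mono fun e he => conjpsd (Ae e) (Be e) he) (conjpsd A B hB)
      ((tAh.mul tB).mul tAh) hs0
    have hre : Continuous fun M : Matrix (Fin n) (Fin n) ℂ => M.trace.re :=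
      Complex.continuous_re.comp (continuous_id.matrix_trace)
    refine le_of_tendsto_of_tendsto ((hre.tendsto _).comp ((tAs.const_mul _).mul tBs))
      ((hre.tendsto _).comp (tX.const_mul _)) ?_
    filter_upwards [hpos] with e he
    exact main_posDef hP (pB e he) _ (fun i j hij => by simpa using hlam hij)
      (fun i => by linarith [hlam0 i]) k hs
end

section
/- Let A be an n×n complex positive semidefinite matrix with spectral decomposition A = Σ_{i=1}^n λ_i P_i, λ_1 ≥ ⋯ ≥ λ_n ≥ 0, let Π_k := Σ_{i=1}^k P_i, and let Ã_k := Π_k A + λ_k (I − Π_k) = Σ_{i=1}^n max{λ_i, λ_k} P_i. Then for every n×n complex positive semidefinite matrix B and every s ∈ [0,1]: Tr[Π_k · (Ã_k^{1/2} B Ã_k^{1/2})^s] ≤ Tr[Π_k · (A^{1/2} B A^{1/2})^s]. -/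
open scoped ComplexOrder

namespace HansenAux

section Hansen
open Set Real MeasureTheory
open scoped NNReal

variable {𝒜 : Type*} [CStarAlgebra 𝒜] [PartialOrder 𝒜] [StarOrderedRing 𝒜]

lemma resolvent_pos {t : ℝ} (ht : 0 < t) {a : 𝒜} (ha : 0 ≤ a) :
    IsStrictlyPositive (algebraMap ℝ 𝒜 t + a) := by grind

lemma integrand_eq {p t : ℝ} (hp : p ∈ Ioo 0 1) (ht : 0 < t) {a : 𝒜} (ha : 0 ≤ a) :
    cfcₙ (rpowIntegrand₀₁ p t) a =
      t ^ (p - 1) • (a * Ring.inverse (algebraMap ℝ 𝒜 t + a)) := by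
  have hspec : ∀ x ∈ spectrum ℝ a, 0 ≤ x := fun x hx => spectrum_nonneg_of_nonneg ha hx
  have hne : ∀ x ∈ spectrum ℝ a, t + x ≠ 0 := fun x hx => by
    have := hspec x hx; positivity
  have hc : ContinuousOn (fun x : ℝ => (t + x)⁻¹) (spectrum ℝ a) :=
    ContinuousOn.inv₀ (by fun_prop) hne
  have hsa : IsSelfAdjoint a := ha.isSelfAdjoint
  have h1 : Ring.inverse (algebraMap ℝ 𝒜 t + a) = cfc (fun x : ℝ => (t + x)⁻¹) a := by
    rw [cfc_inv (fun x : ℝ => t + x) a hne, cfc_const_add t (fun x => x) a, cfc_id' ℝ a]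
  have hco : ContinuousOn (rpowIntegrand₀₁ p t) (quasispectrum ℝ a) :=
    (continuousOn_rpowIntegrand₀₁_Ici hp ht).mono (fun x hx => quasispectrum_nonneg_of_nonneg a ha x hx)
  rw [cfcₙ_eq_cfc hco (by simp), h1]
  have h2 : a * cfc (fun x : ℝ => (t + x)⁻¹) a = cfc (fun x : ℝ => x * (t + x)⁻¹) a := by
    rw [cfc_mul (fun x : ℝ => x) (fun x => (t + x)⁻¹) a (by fun_prop) hc, cfc_id' ℝ a]
  rw [h2, ← cfc_smul _ (fun x : ℝ => x * (t + x)⁻¹) a (continuousOn_id.mul hc)]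
  refine cfc_congr fun x hx => ?_
  simp only [smul_eq_mul]
  rw [rpowIntegrand₀₁_eq_pow_div hp ht.le (hspec x hx)]
  ring

lemma push_through {t : ℝ} (ht : 0 < t) (y : 𝒜) :
    star y * y * Ring.inverse (algebraMap ℝ 𝒜 t + star y * y) =
      star y * Ring.inverse (algebraMap ℝ 𝒜 t + y * star y) * y := by
  have hu := (resolvent_pos ht (star_mul_self_nonneg y)).isUnit
  have hv := (resolvent_pos ht (mul_star_self_nonneg y)).isUnit
  set u := algebraMap ℝ 𝒜 t + star y * y with hu'
  set v := algebraMap ℝ 𝒜 t + y * star y with hv'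
  have h : y * u = v * y := by
    rw [hu', hv', mul_add, add_mul, Algebra.commutes t y, mul_assoc]
  have h2 : Ring.inverse v * y = y * Ring.inverse u := by
    calc Ring.inverse v * y = Ring.inverse v * y * (u * Ring.inverse u) := by
          rw [Ring.mul_inverse_cancel _ hu, mul_one]
      _ = Ring.inverse v * (y * u) * Ring.inverse u := by simp only [mul_assoc]
      _ = Ring.inverse v * v * y * Ring.inverse u := by rw [h]; simp only [mul_assoc]
      _ = _ := by rw [Ring.inverse_mul_cancel _ hv, one_mul]
  rw [mul_assoc (star y) (Ring.inverse v), h2, mul_assoc]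

lemma integrand_hansen {p t : ℝ} (hp : p ∈ Ioo 0 1) (ht : 0 < t) {x c : 𝒜} (hx : 0 ≤ x)
    (hc : c * star c ≤ 1) :
    star c * cfcₙ (rpowIntegrand₀₁ p t) x * c ≤ cfcₙ (rpowIntegrand₀₁ p t) (star c * x * c) := by
  obtain ⟨q, hq0, hq⟩ : ∃ q : 𝒜, 0 ≤ q ∧ q * q = x :=
    ⟨CFC.sqrt x, CFC.sqrt_nonneg x, CFC.sqrt_mul_sqrt_self x hx⟩
  have hqs : star q = q := hq0.isSelfAdjoint
  have hcx : star c * x * c = star (q * c) * (q * c) := by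
    rw [star_mul, hqs, ← hq]; simp only [mul_assoc]
  have hnn : 0 ≤ star c * x * c := by rw [hcx]; exact star_mul_self_nonneg _
  rw [integrand_eq hp ht hx, integrand_eq hp ht hnn, hcx, push_through ht]
  have h1 : x * Ring.inverse (algebraMap ℝ 𝒜 t + x) =
      q * Ring.inverse (algebraMap ℝ 𝒜 t + x) * q := by
    have := push_through ht q
    rwa [hqs, hq] at this
  rw [h1, mul_smul_comm, smul_mul_assoc]
  refine smul_le_smul_of_nonneg_left ?_ (by positivity)
  have hle : q * c * star (q * c) ≤ x := by
    have := star_left_conjugate_le_conjugate hc q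
    rw [hqs, mul_one, hq] at this
    rw [star_mul, hqs]
    simpa only [mul_assoc] using this
  have hinv : Ring.inverse (algebraMap ℝ 𝒜 t + x) ≤
      Ring.inverse (algebraMap ℝ 𝒜 t + q * c * star (q * c)) :=
    CStarAlgebra.ringInverse_le_ringInverse (by gcongr)
      (resolvent_pos ht (mul_star_self_nonneg _))
  have := star_left_conjugate_le_conjugate hinv (q * c)
  refine le_trans (le_of_eq ?_) this
  rw [star_mul, hqs]; simp only [mul_assoc]

lemma hansen {p : ℝ} (hp : p ∈ Icc (0 : ℝ) 1) {x c : 𝒜} (hx : 0 ≤ x)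
    (hc : c * star c ≤ 1) (hc' : star c * c ≤ 1) :
    star c * x ^ p * c ≤ (star c * x * c) ^ p := by
  have hnn : 0 ≤ star c * x * c := star_left_conjugate_nonneg hx c
  obtain ⟨hp0, hp1⟩ := hp
  rcases hp0.eq_or_lt with rfl | hp0
  · rw [CFC.rpow_zero x, CFC.rpow_zero _ hnn, mul_one]; exact hc'
  rcases hp1.eq_or_lt with rfl | hp1
  · rw [CFC.rpow_one x, CFC.rpow_one _ hnn]
  lift p to ℝ≥0 using hp0.le
  have hp0' : 0 < p := by exact_mod_cast hp0
  have hp1' : p < 1 := by exact_mod_cast hp1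
  rw [← CFC.nnrpow_eq_rpow hp0', ← CFC.nnrpow_eq_rpow hp0']
  obtain ⟨μ, hμ⟩ := CFC.exists_measure_nnrpow_eq_integral_cfcₙ_rpowIntegrand₀₁ 𝒜 ⟨hp0', hp1'⟩
  obtain ⟨hi1, he1⟩ := hμ x hx
  obtain ⟨hi2, he2⟩ := hμ _ hnn
  rw [he1, he2]
  let L : 𝒜 →L[ℝ] 𝒜 :=
    ((ContinuousLinearMap.mul ℝ 𝒜).flip c).comp (ContinuousLinearMap.mul ℝ 𝒜 (star c))
  have hL : ∀ z, L z = star c * z * c := fun z => rfl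
  rw [← hL, ← L.integral_comp_comm hi1]
  refine integral_mono_ae (L.integrable_comp hi1) hi2 ?_
  filter_upwards [ae_restrict_mem measurableSet_Ioi] with t ht
  exact integrand_hansen ⟨hp0, hp1⟩ ht hx hc

end Hansen

section Mat
open scoped MatrixOrder Matrix.Norms.L2Operator

variable {n : ℕ}

lemma mpow_eq {X : Matrix (Fin n) (Fin n) ℂ} (hX : X.PosSemidef) (s : ℝ) :
    mpow X s = X ^ s := by
  rw [CFC.rpow_eq_cfc_real (Matrix.nonneg_iff_posSemidef.2 hX)]
  rfl

lemma mpow_half {X S : Matrix (Fin n) (Fin n) ℂ} (hX : X.PosSemidef) (hS : S.PosSemidef)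
    (h : S * S = X) : mpow X (1/2) = S := by
  rw [mpow_eq hX, ← CFC.sqrt_eq_rpow]
  exact CFC.sqrt_unique h (Matrix.nonneg_iff_posSemidef.2 hS)

lemma mpow_hansen {X C : Matrix (Fin n) (Fin n) ℂ} (hX : X.PosSemidef) (hC : C.IsHermitian)
    (hC1 : (1 - C * C).PosSemidef) {s : ℝ} (hs : s ∈ Set.Icc (0 : ℝ) 1) :
    (mpow (C * X * C) s - C * mpow X s * C).PosSemidef := by
  have hCX : (C * X * C).PosSemidef := by
    have := hX.conjTranspose_mul_mul_same C
    rwa [hC.eq] at this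
  have hst : star C = C := hC.eq
  have h1 : C * C ≤ 1 := Matrix.le_iff.2 hC1
  rw [mpow_eq hX, mpow_eq hCX, ← Matrix.le_iff]
  have := hansen (c := C) hs (Matrix.nonneg_iff_posSemidef.2 hX) (by rwa [hst]) (by rwa [hst])
  rwa [hst] at this

end Mat

section Diag

variable {n : ℕ}

/-- Linear combination of the projections. -/
noncomputable def D (P : Fin n → Matrix (Fin n) (Fin n) ℂ) (v : Fin n → ℝ) :
    Matrix (Fin n) (Fin n) ℂ := ∑ i, (v i : ℂ) • P i

variable {P : Fin n → Matrix (Fin n) (Fin n) ℂ}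

lemma D_mul (hPidem : ∀ i, P i * P i = P i) (hPorth : ∀ i j, i ≠ j → P i * P j = 0)
    (u v : Fin n → ℝ) : D P u * D P v = D P (fun i => u i * v i) := by
  unfold D
  rw [Finset.sum_mul]
  refine Finset.sum_congr rfl fun i _ => ?_
  rw [Finset.mul_sum, Finset.sum_eq_single i]
  · rw [smul_mul_smul_comm, hPidem]; push_cast; rfl
  · intro j _ hj
    rw [smul_mul_smul_comm, hPorth i j hj.symm, smul_zero]
  · simp

lemma D_herm (hPherm : ∀ i, (P i).IsHermitian) (v : Fin n → ℝ) : (D P v).IsHermitian := by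
  unfold D Matrix.IsHermitian
  rw [Matrix.conjTranspose_sum]
  refine Finset.sum_congr rfl fun i _ => ?_
  rw [Matrix.conjTranspose_smul, (hPherm i).eq]
  simp

lemma D_psd (hPherm : ∀ i, (P i).IsHermitian) (hPidem : ∀ i, P i * P i = P i)
    (hPorth : ∀ i j, i ≠ j → P i * P j = 0) {v : Fin n → ℝ} (hv : ∀ i, 0 ≤ v i) :
    (D P v).PosSemidef := by
  have h : D P v = (D P (fun i => √(v i))).conjTranspose * D P (fun i => √(v i)) := by
    rw [(D_herm hPherm _).eq, D_mul hPidem hPorth]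
    congr 1; funext i; exact (Real.mul_self_sqrt (hv i)).symm
  rw [h]
  exact Matrix.posSemidef_conjTranspose_mul_self _

lemma D_one (hPsum : ∑ i, P i = 1) : D P (fun _ => 1) = 1 := by
  simp [D, hPsum]

lemma D_add (u v : Fin n → ℝ) : D P u + D P v = D P (fun i => u i + v i) := by
  simp [D, ← Finset.sum_add_distrib, add_smul]

lemma D_sub (u v : Fin n → ℝ) : D P u - D P v = D P (fun i => u i - v i) := by
  simp [D, ← Finset.sum_sub_distrib, sub_smul]

lemma D_smul (r : ℝ) (v : Fin n → ℝ) : (r : ℂ) • D P v = D P (fun i => r * v i) := by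
  unfold D
  rw [Finset.smul_sum]
  refine Finset.sum_congr rfl fun i _ => ?_
  rw [smul_smul, Complex.ofReal_mul]

end Diag

end HansenAux

/-- Lemma 2 (case `s ∈ [0,1]`): with `A = Σ_i λ_i P_i` a spectral decomposition with eigenvalues
in nonincreasing order, `Π_k = Σ_{i ≤ k} P_i` and `Ã_k = Π_k A + λ_k (I - Π_k)`, for all PSD `B`
and `s ∈ [0,1]`: `Tr[Π_k (Ã_k^{1/2} B Ã_k^{1/2})^s] ≤ Tr[Π_k (A^{1/2} B A^{1/2})^s]`. -/
theorem stmt_2 {n : ℕ} (A B : Matrix (Fin n) (Fin n) ℂ) (hB : B.PosSemidef)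
    (lam : Fin n → ℝ) (P : Fin n → Matrix (Fin n) (Fin n) ℂ)
    (hlam : Antitone lam) (hlam0 : ∀ i, 0 ≤ lam i)
    (hPherm : ∀ i, (P i).IsHermitian)
    (hPidem : ∀ i, P i * P i = P i)
    (hPorth : ∀ i j, i ≠ j → P i * P j = 0)
    (hPsum : ∑ i, P i = 1)
    (hA : A = ∑ i, (lam i : ℂ) • P i)
    (k : Fin n) (s : ℝ) (hs : s ∈ Set.Icc (0 : ℝ) 1)
    (Pik Atk : Matrix (Fin n) (Fin n) ℂ)
    (hPik : Pik = ∑ i ∈ Finset.Iic k, P i)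
    (hAtk : Atk = Pik * A + (lam k : ℂ) • (1 - Pik)) :
    (Matrix.trace (Pik * mpow (mpow Atk (1/2) * B * mpow Atk (1/2)) s)).re ≤
      (Matrix.trace (Pik * mpow (mpow A (1/2) * B * mpow A (1/2)) s)).re := by
  have hmul := HansenAux.D_mul hPidem hPorth
  have hherm := HansenAux.D_herm hPherm
  have hpsd := fun {v : Fin n → ℝ} (hv : ∀ i, 0 ≤ v i) =>
    HansenAux.D_psd hPherm hPidem hPorth hv
  have hone := HansenAux.D_one hPsum
  let e : Fin n → ℝ := fun i => if i ≤ k then 1 else 0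
  let mu : Fin n → ℝ := fun i => if i ≤ k then lam i else lam k
  let c : Fin n → ℝ := fun i => if i ≤ k then 1 else √(lam i / lam k)
  have hmu0 : ∀ i, 0 ≤ mu i := fun i => by
    simp only [mu]; split_ifs <;> exact hlam0 _
  have hc0 : ∀ i, 0 ≤ c i := fun i => by
    simp only [c]; split_ifs <;> positivity
  have hc1 : ∀ i, c i ≤ 1 := fun i => by
    simp only [c]; split_ifs with h
    · exact le_rfl
    · rw [Real.sqrt_le_one]
      exact div_le_one_of_le₀ (hlam (not_le.1 h).le) (hlam0 k)
  have hcm : ∀ i, c i * √(mu i) = √(lam i) := fun i => by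
    simp only [c, mu]; split_ifs with h
    · rw [one_mul]
    · rw [← Real.sqrt_mul (div_nonneg (hlam0 i) (hlam0 k))]
      congr 1
      by_cases h0 : lam k = 0
      · have := hlam (not_le.1 h).le
        have := hlam0 i
        rw [h0]; simp; linarith
      · exact div_mul_cancel₀ _ h0
  have hce : ∀ i, c i * e i = e i := fun i => by
    simp only [c, e]; split_ifs <;> simp
  have hPe : Pik = HansenAux.D P e := by
    rw [hPik]
    simp only [HansenAux.D, e]
    have hI : Finset.Iic k = Finset.univ.filter (fun i => i ≤ k) := by ext i; simp
    rw [hI, Finset.sum_filter]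
    refine Finset.sum_congr rfl fun i _ => ?_
    split_ifs <;> simp
  have hAD : A = HansenAux.D P lam := hA
  have hAt : Atk = HansenAux.D P mu := by
    rw [hAtk, hPe, hAD, hmul, ← hone, HansenAux.D_sub, HansenAux.D_smul, HansenAux.D_add]
    congr 1; funext i; simp only [e, mu]; split_ifs <;> simp
  have hA2 : mpow A (1/2) = HansenAux.D P (fun i => √(lam i)) := by
    rw [hAD]
    refine HansenAux.mpow_half (hpsd hlam0) (hpsd fun i => Real.sqrt_nonneg _) ?_
    rw [hmul]; congr 1; funext i; exact Real.mul_self_sqrt (hlam0 i)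
  have hAt2 : mpow Atk (1/2) = HansenAux.D P (fun i => √(mu i)) := by
    rw [hAt]
    refine HansenAux.mpow_half (hpsd hmu0) (hpsd fun i => Real.sqrt_nonneg _) ?_
    rw [hmul]; congr 1; funext i; exact Real.mul_self_sqrt (hmu0 i)
  rw [hA2, hAt2]
  set S := HansenAux.D P (fun i => √(mu i)) with hS
  set C := HansenAux.D P c with hC
  have hSC : S * C = HansenAux.D P (fun i => √(lam i)) := by
    rw [hS, hC, hmul]; congr 1; funext i; rw [mul_comm]; exact hcm i
  have hCS : C * S = HansenAux.D P (fun i => √(lam i)) := by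
    rw [hS, hC, hmul]; congr 1; funext i; exact hcm i
  have hX : (S * B * S).PosSemidef := by
    have := hB.conjTranspose_mul_mul_same S
    rwa [(hherm _).eq] at this
  have heq : HansenAux.D P (fun i => √(lam i)) * B * HansenAux.D P (fun i => √(lam i)) =
      C * (S * B * S) * C := by
    nth_rw 1 [← hCS]; rw [← hSC]; simp only [mul_assoc]
  rw [heq]
  have hC1 : (1 - C * C).PosSemidef := by
    rw [hC, hmul, ← hone, HansenAux.D_sub]
    refine hpsd fun i => ?_
    have := hc0 i
    have := hc1 i
    nlinarith
  have key := HansenAux.mpow_hansen hX (hherm c) hC1 hs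
  rw [← hC] at key
  set X := S * B * S
  have hCP : C * Pik = Pik := by
    rw [hC, hPe, hmul]; congr 1; funext i; exact hce i
  have hPC : Pik * C = Pik := by
    rw [hC, hPe, hmul]; congr 1; funext i; rw [mul_comm]; exact hce i
  have hPP : Pik * Pik = Pik := by
    rw [hPe, hmul]; congr 1; funext i; simp only [e]; split_ifs <;> simp
  have hPH : Pik.conjTranspose = Pik := by rw [hPe]; exact (hherm _).eq
  have hnn := (key.conjTranspose_mul_mul_same Pik).trace_nonneg
  rw [hPH, Matrix.trace_mul_comm, ← mul_assoc, hPP, mul_sub, Matrix.trace_sub] at hnn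
  have ht : (Pik * (C * mpow X s * C)).trace = (Pik * mpow X s).trace := by
    rw [← mul_assoc, ← mul_assoc, hPC, Matrix.trace_mul_comm, ← mul_assoc, hCP]
  rw [ht] at hnn
  have := (Complex.le_def.1 hnn).1
  simpa using this
end

section
/- Let A be an n×n complex positive semidefinite matrix with spectral decomposition A = Σ_{i=1}^n λ_i P_i, λ_1 ≥ ⋯ ≥ λ_n ≥ 0, let Π_k := Σ_{i=1}^k P_i, and let Ã_k := Π_k A + λ_k (I − Π_k) = Σ_{i=1}^n max{λ_i, λ_k} P_i. Then for every n×n complex positive semidefinite matrix B and every s ∈ [1,2]: Tr[Π_k · (A^{1/2} B A^{1/2})^s] ≤ Tr[Π_k · (Ã_k^{1/2} B Ã_k^{1/2})^s]. -/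
open scoped ComplexOrder

open Matrix Polynomial

theorem aux_interp (f : ℝ → ℝ) (S : Finset ℝ) : ∃ q : ℝ[X], ∀ x ∈ S, q.eval x = f x := by
  refine ⟨Lagrange.interpolate S id f, fun x hx => ?_⟩
  exact Lagrange.eval_interpolate_at_node (v := id) f (Function.injective_id.injOn) hx

/-- `cfc` as a polynomial. -/
theorem aux_cfc {n : ℕ} (X : Matrix (Fin n) (Fin n) ℂ) (hX : X.IsHermitian) (f : ℝ → ℝ)
    (q : ℝ[X]) (h : ∀ x ∈ spectrum ℝ X, q.eval x = f x) : cfc f X = aeval X q := by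
  have hX' : IsSelfAdjoint X := hX
  rw [← cfc_polynomial q X hX']
  exact cfc_congr fun x hx => (h x hx).symm

section order
open scoped MatrixOrder Matrix.Norms.L2Operator

theorem aux_LH {n : ℕ} (X Y : Matrix (Fin n) (Fin n) ℂ) (hX : X.PosSemidef)
    (h : (Y - X).PosSemidef) (r : ℝ) (hr : r ∈ Set.Icc (0 : ℝ) 1) :
    (mpow Y r - mpow X r).PosSemidef := by
  have hX0 : 0 ≤ X := hX.nonneg
  have hXY : X ≤ Y := Matrix.le_iff.2 h
  have := CFC.rpow_le_rpow hr hXY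
  rw [CFC.rpow_eq_cfc_real hX0, CFC.rpow_eq_cfc_real (hX0.trans hXY)] at this
  exact Matrix.le_iff.1 this

theorem aux_sqrt {n : ℕ} (X : Matrix (Fin n) (Fin n) ℂ) (hX : X.PosSemidef) :
    ∃ C : Matrix (Fin n) (Fin n) ℂ, X = Cᴴ * C :=
  CStarAlgebra.nonneg_iff_eq_star_mul_self.1 hX.nonneg

theorem aux_spec {n : ℕ} (X : Matrix (Fin n) (Fin n) ℂ) (hX : X.PosSemidef) :
    ∀ x ∈ spectrum ℝ X, 0 ≤ x := fun _ hx => spectrum_nonneg_of_nonneg hX.nonneg hx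

end order

theorem aux_intertwine {n : ℕ} (U V : Matrix (Fin n) (Fin n) ℂ) (q : ℝ[X]) :
    aeval (U * V) q * U = U * aeval (V * U) q := by
  induction q using Polynomial.induction_on' with
  | add p q hp hq => simp only [map_add, add_mul, mul_add, hp, hq]
  | monomial k a =>
    simp only [aeval_monomial]
    have : (U * V) ^ k * U = U * (V * U) ^ k := by
      induction k with
      | zero => simp
      | succ k ih => rw [pow_succ', mul_assoc, ih, pow_succ']; simp only [mul_assoc]
    rw [mul_assoc, this, ← mul_assoc, ← mul_assoc, Algebra.commutes]

theorem aux_pow {n : ℕ} (Z : Matrix (Fin n) (Fin n) ℂ) (r : ℝ) (hr : 0 ≤ r) :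
    mpow (Zᴴ * Z) (r + 1) = Zᴴ * mpow (Z * Zᴴ) r * Z := by
  obtain ⟨q, hq⟩ := aux_interp (fun x => x ^ r)
    ((finite_real_spectrum (A := Zᴴ * Z)).toFinset ∪ (finite_real_spectrum (A := Z * Zᴴ)).toFinset)
  have h1 : mpow (Z * Zᴴ) r = aeval (Z * Zᴴ) q :=
    aux_cfc _ (isHermitian_mul_conjTranspose_self Z) _ q fun x hx => hq x (by simp [hx])
  have h2 : mpow (Zᴴ * Z) (r + 1) = aeval (Zᴴ * Z) (q * X) := by
    refine aux_cfc _ (isHermitian_conjTranspose_mul_self Z) _ _ fun x hx => ?_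
    have h0 := aux_spec _ (posSemidef_conjTranspose_mul_self Z) x hx
    rw [eval_mul, eval_X, hq x (by simp [hx]), Real.rpow_add_of_nonneg h0 hr zero_le_one,
      Real.rpow_one]
  rw [h1, h2, map_mul, aeval_X, ← mul_assoc, aux_intertwine]

/-- functional calculus of a spectral decomposition -/
theorem aux_aeval {n : ℕ} (lam : Fin n → ℝ) (P : Fin n → Matrix (Fin n) (Fin n) ℂ)
    (hPidem : ∀ i, P i * P i = P i)
    (hPorth : ∀ i j, i ≠ j → P i * P j = 0)
    (hPsum : ∑ i, P i = 1) (q : ℝ[X]) :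
    aeval (∑ i, lam i • P i) q = ∑ i, q.eval (lam i) • P i := by
  induction q using Polynomial.induction_on with
  | C a => simp [← Finset.smul_sum, hPsum, Algebra.algebraMap_eq_smul_one]
  | add p q hp hq => simp [hp, hq, add_smul, Finset.sum_add_distrib]
  | monomial k a h =>
    rw [pow_succ, ← mul_assoc, map_mul, h, aeval_X, Finset.sum_mul_sum]
    refine Finset.sum_congr rfl fun i _ => ?_
    rw [Finset.sum_eq_single i]
    · simp [hPidem, smul_smul]; ring_nf
    · intro j _ hj
      simp [hPorth i j hj.symm]
    · simp

theorem aux_herm {n : ℕ} (lam : Fin n → ℝ) (P : Fin n → Matrix (Fin n) (Fin n) ℂ)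
    (hPherm : ∀ i, (P i).IsHermitian) : (∑ i, lam i • P i).IsHermitian := by
  unfold Matrix.IsHermitian
  rw [conjTranspose_sum]
  refine Finset.sum_congr rfl fun i _ => ?_
  rw [conjTranspose_smul, (hPherm i).eq]; simp

theorem aux_fc {n : ℕ} (lam : Fin n → ℝ) (P : Fin n → Matrix (Fin n) (Fin n) ℂ)
    (hPherm : ∀ i, (P i).IsHermitian)
    (hPidem : ∀ i, P i * P i = P i)
    (hPorth : ∀ i j, i ≠ j → P i * P j = 0)
    (hPsum : ∑ i, P i = 1) (t : ℝ) :
    mpow (∑ i, lam i • P i) t = ∑ i, (lam i) ^ t • P i := by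
  obtain ⟨q, hq⟩ := aux_interp (fun x => x ^ t)
    ((finite_real_spectrum (A := ∑ i, lam i • P i)).toFinset ∪ Finset.univ.image lam)
  rw [mpow, aux_cfc _ (aux_herm lam P hPherm) _ q fun x hx => hq x (by simp [hx]),
    aux_aeval lam P hPidem hPorth hPsum]
  exact Finset.sum_congr rfl fun i _ => by rw [hq _ (by simp)]

theorem aux_mul {n : ℕ} (a b : Fin n → ℝ) (P : Fin n → Matrix (Fin n) (Fin n) ℂ)
    (hPidem : ∀ i, P i * P i = P i)
    (hPorth : ∀ i j, i ≠ j → P i * P j = 0) :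
    (∑ i, a i • P i) * (∑ i, b i • P i) = ∑ i, (a i * b i) • P i := by
  rw [Finset.sum_mul_sum]
  refine Finset.sum_congr rfl fun i _ => ?_
  rw [Finset.sum_eq_single i]
  · simp [hPidem, smul_smul, mul_comm]
  · intro j _ hj
    simp [hPorth i j hj.symm]
  · simp

theorem aux_psd {n : ℕ} (a : Fin n → ℝ) (ha : ∀ i, 0 ≤ a i)
    (P : Fin n → Matrix (Fin n) (Fin n) ℂ)
    (hPherm : ∀ i, (P i).IsHermitian) (hPidem : ∀ i, P i * P i = P i) :
    (∑ i, a i • P i).PosSemidef := by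
  refine posSemidef_sum _ fun i _ => ?_
  have : (P i).PosSemidef := by
    have h := posSemidef_conjTranspose_mul_self (P i)
    rwa [(hPherm i).eq, hPidem] at h
  exact this.smul (ha i)

theorem aux_trace {n : ℕ} (Q M : Matrix (Fin n) (Fin n) ℂ) (hQ : Q.IsHermitian) (hQ2 : Q * Q = Q)
    (hM : M.PosSemidef) : 0 ≤ (trace (Q * M)).re := by
  have h := (hM.conjTranspose_mul_mul_same Q).trace_nonneg
  rw [hQ.eq, trace_mul_comm, ← mul_assoc, hQ2] at h
  exact (Complex.le_def.1 h).1

/-- Core inequality. -/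
theorem aux_core {n : ℕ} (Q K Z : Matrix (Fin n) (Fin n) ℂ) (hQ : Q.IsHermitian) (hQ2 : Q * Q = Q)
    (hK : K.IsHermitian) (hK1 : (1 - K * K).PosSemidef) (hKQ : K * Q * K = Q)
    (s : ℝ) (hs : s ∈ Set.Icc (1 : ℝ) 2) :
    (trace (Q * mpow ((Z * K)ᴴ * (Z * K)) s)).re ≤ (trace (Q * mpow (Zᴴ * Z) s)).re := by
  obtain ⟨r, rfl⟩ : ∃ r, s = r + 1 := ⟨s - 1, by ring⟩
  have hr : r ∈ Set.Icc (0 : ℝ) 1 := ⟨by linarith [hs.1], by linarith [hs.2]⟩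
  have h1 : (Z * Zᴴ - (Z * K) * (Z * K)ᴴ).PosSemidef := by
    have := hK1.mul_mul_conjTranspose_same Z
    convert this using 1
    rw [conjTranspose_mul, hK.eq]
    simp only [mul_sub, sub_mul, mul_one, mul_assoc]
  have h2 := aux_LH _ _ (posSemidef_self_mul_conjTranspose (Z * K)) h1 r hr
  have h3 := aux_trace Q _ hQ hQ2 (h2.conjTranspose_mul_mul_same (Z * K))
  rw [aux_pow _ _ hr.1, aux_pow _ _ hr.1]
  rw [mul_sub, sub_mul, mul_sub, trace_sub, Complex.sub_re] at h3
  have h4 : trace (Q * ((Z * K)ᴴ * mpow (Z * Zᴴ) r * (Z * K))) =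
      trace (Q * (Zᴴ * mpow (Z * Zᴴ) r * Z)) := by
    rw [conjTranspose_mul, hK.eq]
    have h5 : ∀ W, trace (Q * (K * W * K)) = trace (K * Q * K * W) := fun W => by
      rw [show Q * (K * W * K) = (Q * K * W) * K by simp only [mul_assoc], trace_mul_comm]
      simp only [mul_assoc]
    have h6 := h5 (Zᴴ * mpow (Z * Zᴴ) r * Z)
    rw [hKQ] at h6
    rw [← h6]
    simp only [mul_assoc]
  rw [h4] at h3
  linarith

theorem stmt_3 {n : ℕ} (A B : Matrix (Fin n) (Fin n) ℂ) (hB : B.PosSemidef)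
    (lam : Fin n → ℝ) (P : Fin n → Matrix (Fin n) (Fin n) ℂ)
    (hlam : Antitone lam) (hlam0 : ∀ i, 0 ≤ lam i)
    (hPherm : ∀ i, (P i).IsHermitian)
    (hPidem : ∀ i, P i * P i = P i)
    (hPorth : ∀ i j, i ≠ j → P i * P j = 0)
    (hPsum : ∑ i, P i = 1)
    (hA : A = ∑ i, (lam i : ℂ) • P i)
    (k : Fin n) (s : ℝ) (hs : s ∈ Set.Icc (1 : ℝ) 2)
    (Pik Atk : Matrix (Fin n) (Fin n) ℂ)
    (hPik : Pik = ∑ i ∈ Finset.Iic k, P i)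
    (hAtk : Atk = Pik * A + (lam k : ℂ) • (1 - Pik)) :
    (Matrix.trace (Pik * mpow (mpow A (1/2) * B * mpow A (1/2)) s)).re ≤
      (Matrix.trace (Pik * mpow (mpow Atk (1/2) * B * mpow Atk (1/2)) s)).re := by
  have hM := fun a b => aux_mul a b P hPidem hPorth
  have hA' : A = ∑ i, lam i • P i := by simpa using! hA
  have hPik' : Pik = ∑ i, (if i ≤ k then (1 : ℝ) else 0) • P i := by
    rw [hPik]
    simp only [ite_smul, one_smul, zero_smul]
    rw [← Finset.sum_filter]
    congr 1
    ext i; simp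
  have hAtk' : Atk = ∑ i, (if i ≤ k then lam i else lam k) • P i := by
    have e : (lam k : ℂ) • (1 - Pik) = lam k • (1 - Pik) := by simp
    rw [hAtk, e, ← hPsum, hPik', hA', hM, ← Finset.sum_sub_distrib, Finset.smul_sum,
      ← Finset.sum_add_distrib]
    refine Finset.sum_congr rfl fun i _ => ?_
    split_ifs <;> simp
  set c : Fin n → ℝ := fun i => if i ≤ k then 1 else (lam i / lam k) ^ (1 / 2 : ℝ) with hc
  set K := ∑ i, c i • P i with hK
  have hF := fun l => aux_fc l P hPherm hPidem hPorth hPsum (1 / 2)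
  have hAK : mpow A (1 / 2) = mpow Atk (1 / 2) * K := by
    rw [hA', hAtk', hF, hF, hM]
    refine Finset.sum_congr rfl fun i _ => ?_
    congr 1
    simp only [hc]
    split_ifs with h
    · simp
    · rw [← Real.mul_rpow (hlam0 k) (div_nonneg (hlam0 i) (hlam0 k))]
      rcases (hlam0 k).eq_or_lt with h0 | h0
      · have : lam i = 0 := le_antisymm (h0 ▸ hlam (le_of_not_ge h)) (hlam0 i)
        simp [this]
      · rw [mul_div_cancel₀ _ h0.ne']
  have hAKh : mpow A (1 / 2) = K * mpow Atk (1 / 2) := by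
    rw [hAK, hAtk', hF, hM, hM]
    simp only [mul_comm]
  have hT : (mpow Atk (1 / 2)).IsHermitian := by
    rw [hAtk', hF]; exact aux_herm _ P hPherm
  have hKh : K.IsHermitian := aux_herm _ P hPherm
  obtain ⟨C, hC⟩ := aux_sqrt B hB
  have hQ : Pik.IsHermitian := by rw [hPik']; exact aux_herm _ P hPherm
  have hQ2 : Pik * Pik = Pik := by
    rw [hPik', hM]
    exact Finset.sum_congr rfl fun i _ => by split_ifs <;> simp
  have hKQ : K * Pik * K = Pik := by
    rw [hPik', hM, hM]
    refine Finset.sum_congr rfl fun i _ => ?_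
    simp only [hc]
    split_ifs <;> simp
  have hK1 : (1 - K * K).PosSemidef := by
    rw [← hPsum, hM, ← Finset.sum_sub_distrib]
    have : ∀ i, P i - (c i * c i) • P i = (1 - c i * c i) • P i := fun i => by
      rw [sub_smul, one_smul]
    simp only [this]
    refine aux_psd _ (fun i => ?_) P hPherm hPidem
    have h0 : 0 ≤ c i ∧ c i ≤ 1 := by
      simp only [hc]
      split_ifs with h
      · simp
      · have hd := div_nonneg (hlam0 i) (hlam0 k)
        exact ⟨Real.rpow_nonneg hd _, Real.rpow_le_one hd
          (div_le_one_of_le₀ (hlam (le_of_not_ge h)) (hlam0 k)) (by norm_num)⟩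
    nlinarith [h0.1, h0.2]
  have key := aux_core Pik K (C * mpow Atk (1 / 2)) hQ hQ2 hKh hK1 hKQ s hs
  have e1 : (C * mpow Atk (1 / 2) * K)ᴴ * (C * mpow Atk (1 / 2) * K) =
      mpow A (1 / 2) * B * mpow A (1 / 2) := by
    rw [conjTranspose_mul, conjTranspose_mul, hKh.eq, hT.eq, ← mul_assoc K, ← hAKh,
      mul_assoc C, ← hAK, hC]
    simp only [mul_assoc]
  have e2 : (C * mpow Atk (1 / 2))ᴴ * (C * mpow Atk (1 / 2)) =
      mpow Atk (1 / 2) * B * mpow Atk (1 / 2) := by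
    rw [conjTranspose_mul, hT.eq, hC]
    simp only [mul_assoc]
  rw [e1, e2] at key
  exact key
end

section
/- Let A be an n×n complex positive definite matrix and B an n×n complex positive semidefinite matrix. Then for every s ∈ [0,1] and every real t ≤ −s: Tr[A^t · (A^{1/2} B A^{1/2})^s] ≤ Tr[A^t · A^s · B^s] = Tr[A^{t+s} B^s]. -/
open scoped ComplexOrder

section Aux

open scoped MatrixOrder Matrix.Norms.L2Operator

variable {n : ℕ}

theorem aux_cont (A : Matrix (Fin n) (Fin n) ℂ) (f : ℝ → ℝ) : ContinuousOn f (spectrum ℝ A) :=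
  A.finite_real_spectrum.continuousOn f

theorem aux_cont' (A : Matrix (Fin n) (Fin n) ℂ) (f g : ℝ → ℝ) :
    ContinuousOn g (f '' spectrum ℝ A) :=
  (A.finite_real_spectrum.image f).continuousOn g

theorem mpow_eq {A : Matrix (Fin n) (Fin n) ℂ} (s : ℝ) (h : A.PosSemidef) :
    mpow A s = A ^ s := by
  rw [mpow, CFC.rpow_eq_cfc_real (Matrix.nonneg_iff_posSemidef.2 h)]

theorem mpow_mono {A B : Matrix (Fin n) (Fin n) ℂ} {s : ℝ} (hs : s ∈ Set.Icc (0:ℝ) 1)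
    (h : A.PosSemidef) (hAB : A ≤ B) : mpow A s ≤ mpow B s := by
  have hB : B.PosSemidef :=
    Matrix.nonneg_iff_posSemidef.1 ((Matrix.nonneg_iff_posSemidef.2 h).trans hAB)
  rw [mpow_eq _ h, mpow_eq _ hB]
  exact CFC.rpow_le_rpow hs hAB

theorem spec_pos {A : Matrix (Fin n) (Fin n) ℂ} (hA : A.PosDef) {x : ℝ}
    (hx : x ∈ spectrum ℝ A) : 0 < x := by
  have h := Matrix.isStrictlyPositive_iff_posDef.2 hA
  exact h.spectrum_pos hx

theorem spec_nonneg {A : Matrix (Fin n) (Fin n) ℂ} (hA : A.PosSemidef) {x : ℝ}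
    (hx : x ∈ spectrum ℝ A) : 0 ≤ x := 
  spectrum_nonneg_of_nonneg (Matrix.nonneg_iff_posSemidef.2 hA) hx

theorem cfc_pd {A : Matrix (Fin n) (Fin n) ℂ} (hA : A.IsHermitian) {f : ℝ → ℝ}
    (hf : ∀ x ∈ spectrum ℝ A, 0 < f x) : (cfc f A).PosDef := by
  rw [← Matrix.isStrictlyPositive_iff_posDef]
  exact (cfc_isStrictlyPositive_iff f A (aux_cont A f) hA.isSelfAdjoint).2 hf

theorem cfc_psd {A : Matrix (Fin n) (Fin n) ℂ} {f : ℝ → ℝ}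
    (hf : ∀ x ∈ spectrum ℝ A, 0 ≤ f x) : (cfc f A).PosSemidef := by
  rw [← Matrix.nonneg_iff_posSemidef]
  exact cfc_nonneg hf

theorem mpow_pd {A : Matrix (Fin n) (Fin n) ℂ} (hA : A.PosDef) (r : ℝ) : (mpow A r).PosDef :=
  cfc_pd hA.isHermitian fun _ hx => Real.rpow_pos_of_pos (spec_pos hA hx) r

theorem mpow_psd {A : Matrix (Fin n) (Fin n) ℂ} (hA : A.PosSemidef) (r : ℝ) :
    (mpow A r).PosSemidef :=
  cfc_psd fun _ hx => Real.rpow_nonneg (spec_nonneg hA hx) r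

theorem mpow_cfc {A : Matrix (Fin n) (Fin n) ℂ} (hA : A.IsHermitian) (f : ℝ → ℝ) (r : ℝ) :
    mpow (cfc f A) r = cfc (fun x => f x ^ r) A := by
  rw [mpow, ← cfc_comp' (fun x => x ^ r) f A (aux_cont' A f _) (aux_cont A f) hA.isSelfAdjoint]

theorem cfc_mul_mat (A : Matrix (Fin n) (Fin n) ℂ) (f g : ℝ → ℝ) :
    cfc f A * cfc g A = cfc (fun x => f x * g x) A :=
  (cfc_mul f g A (aux_cont A f) (aux_cont A g)).symm

theorem cfc_id_mat {A : Matrix (Fin n) (Fin n) ℂ} (hA : A.IsHermitian) :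
    cfc (fun x : ℝ => x) A = A := cfc_id' ℝ A hA.isSelfAdjoint

theorem mpow_add_s4 {A : Matrix (Fin n) (Fin n) ℂ} (hA : A.PosDef) (a b : ℝ) :
    mpow A a * mpow A b = mpow A (a + b) := by
  rw [mpow, mpow, cfc_mul_mat, mpow]
  exact cfc_congr fun x hx => (Real.rpow_add (spec_pos hA hx) a b).symm

theorem mpow_mpow {A : Matrix (Fin n) (Fin n) ℂ} (hA : A.PosDef) (a b : ℝ) :
    mpow (mpow A a) b = mpow A (a * b) := by
  rw [mpow.eq_def A, mpow_cfc hA.isHermitian, mpow]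
  exact cfc_congr fun x hx => (Real.rpow_mul (spec_pos hA hx).le a b).symm

theorem mpow_one' {A : Matrix (Fin n) (Fin n) ℂ} (hA : A.IsHermitian) : mpow A 1 = A := by
  rw [mpow]; simp only [Real.rpow_one]; exact cfc_id_mat hA

theorem mpow_zero' {A : Matrix (Fin n) (Fin n) ℂ} (hA : A.IsHermitian) : mpow A 0 = 1 := by
  rw [mpow]; simp only [Real.rpow_zero]; exact cfc_const_one ℝ A hA.isSelfAdjoint

theorem mpow_smul_s4 {A : Matrix (Fin n) (Fin n) ℂ} (hA : A.PosDef) {c : ℝ} (hc : 0 < c) (r : ℝ) :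
    mpow (c • A) r = (c ^ r) • mpow A r := by
  have h : c • A = cfc (fun x => c * x) A := (cfc_const_mul_id c A hA.isHermitian.isSelfAdjoint).symm
  rw [h, mpow_cfc hA.isHermitian, mpow, ← cfc_smul _ _ _ (aux_cont A _)]
  exact cfc_congr fun x hx => by
    simp [Real.mul_rpow hc.le (spec_pos hA hx).le]

theorem mpow_anti_s4 {A B : Matrix (Fin n) (Fin n) ℂ} {r : ℝ} (hr : r ∈ Set.Icc (-1:ℝ) 0)
    (h : A.PosDef) (hB : B.PosDef) (hAB : A ≤ B) : mpow B r ≤ mpow A r := by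
  have e : ∀ {X : Matrix (Fin n) (Fin n) ℂ}, X.PosDef → mpow X r = mpow (mpow X (-1)) (-r) := by
    intro X hX
    rw [mpow_mpow hX]; congr 1; ring
  rw [e h, e hB]
  apply mpow_mono (by constructor <;> linarith [hr.1, hr.2]) (mpow_pd hB _).posSemidef
  rw [mpow_eq _ h.posSemidef, mpow_eq _ hB.posSemidef]
  exact CStarAlgebra.rpow_neg_one_le_rpow_neg_one hAB (Matrix.isStrictlyPositive_iff_posDef.2 h)

theorem tr_nonneg {X Y : Matrix (Fin n) (Fin n) ℂ} (hX : X.PosSemidef) (hY : Y.PosSemidef) :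
    0 ≤ (Matrix.trace (X * Y)).re := by
  have h := mpow_psd hX (1/2)
  have e : mpow X (1/2) * mpow X (1/2) = X := by
    rw [mpow, cfc_mul_mat]
    conv_rhs => rw [← cfc_id_mat hX.isHermitian]
    exact cfc_congr fun x hx => by
      rcases (spec_nonneg hX hx).eq_or_lt with h | h
      · simp [← h]
      · rw [← Real.rpow_add h]; norm_num
  rw [← e, mul_assoc, Matrix.trace_mul_comm]
  have := (hY.mul_mul_conjTranspose_same (mpow X (1/2))).trace_nonneg
  rw [h.isHermitian.eq] at this
  exact (Complex.le_def.1 this).1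

theorem tr_mono {X Y Y' : Matrix (Fin n) (Fin n) ℂ} (hX : X.PosSemidef) (hY : Y ≤ Y') :
    (Matrix.trace (X * Y)).re ≤ (Matrix.trace (X * Y')).re := by
  have := tr_nonneg hX (Matrix.le_iff.1 hY)
  rw [mul_sub, Matrix.trace_sub, Complex.sub_re] at this
  linarith

theorem cfc_diag {A : Matrix (Fin n) (Fin n) ℂ} (hA : A.IsHermitian) (f : ℝ → ℝ) :
    cfc f A = (hA.eigenvectorUnitary : Matrix (Fin n) (Fin n) ℂ) *
      Matrix.diagonal (fun i => ((f (hA.eigenvalues i) : ℝ) : ℂ)) *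
      star (hA.eigenvectorUnitary : Matrix (Fin n) (Fin n) ℂ) := by
  rw [hA.cfc_eq, Matrix.IsHermitian.cfc, Unitary.conjStarAlgAut_apply]
  rfl

theorem tr_one {A : Matrix (Fin n) (Fin n) ℂ} (hA : A.IsHermitian) (M : Matrix (Fin n) (Fin n) ℂ) :
    ∃ m : Fin n → ℝ, (M.PosSemidef → ∀ i, 0 ≤ m i) ∧ ∀ g : ℝ → ℝ,
      (Matrix.trace (cfc g A * M)).re = ∑ i, g (hA.eigenvalues i) * m i := by
  refine ⟨fun i => ((star (hA.eigenvectorUnitary : Matrix (Fin n) (Fin n) ℂ) * M *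
    (hA.eigenvectorUnitary : Matrix (Fin n) (Fin n) ℂ)) i i).re, fun hM i => ?_, fun g => ?_⟩
  · have := (hM.conjTranspose_mul_mul_same
      (hA.eigenvectorUnitary : Matrix (Fin n) (Fin n) ℂ)).diag_nonneg (i := i)
    exact (Complex.le_def.1 this).1
  rw [cfc_diag hA, mul_assoc, mul_assoc, Matrix.trace_mul_comm, mul_assoc, Matrix.trace]
  simp [Matrix.diagonal_mul, Complex.re_sum]

theorem tr_two {A B : Matrix (Fin n) (Fin n) ℂ} (hA : A.IsHermitian) (hB : B.IsHermitian) :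
    ∃ w : Fin n → Fin n → ℝ, (∀ i j, 0 ≤ w i j) ∧ ∀ f g : ℝ → ℝ,
      (Matrix.trace (cfc f A * cfc g B)).re =
        ∑ i, ∑ j, f (hA.eigenvalues i) * g (hB.eigenvalues j) * w i j := by
  set U := (hA.eigenvectorUnitary : Matrix (Fin n) (Fin n) ℂ) with hU
  set V := (hB.eigenvectorUnitary : Matrix (Fin n) (Fin n) ℂ) with hV
  refine ⟨fun i j => Complex.normSq ((star U * V) i j), fun i j => Complex.normSq_nonneg _,
    fun f g => ?_⟩
  rw [cfc_diag hA, cfc_diag hB, ← hU, ← hV]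
  set F := Matrix.diagonal (fun i => ((f (hA.eigenvalues i) : ℝ) : ℂ))
  set G := Matrix.diagonal (fun i => ((g (hB.eigenvalues i) : ℝ) : ℂ))
  have e : Matrix.trace (U * F * star U * (V * G * star V)) =
      Matrix.trace (F * ((star U * V) * G * star (star U * V))) := by
    rw [star_mul, star_star]
    rw [mul_assoc U, mul_assoc U, Matrix.trace_mul_comm]
    simp only [mul_assoc]
  rw [e, Matrix.trace]
  simp only [Matrix.diag_apply, F, Matrix.diagonal_mul, Complex.re_sum]
  refine Finset.sum_congr rfl fun i _ => ?_
  rw [Matrix.mul_apply, Complex.re_ofReal_mul, Complex.re_sum, Finset.mul_sum]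
  refine Finset.sum_congr rfl fun j _ => ?_
  simp only [G, Matrix.mul_diagonal, Matrix.star_apply]
  generalize (star U * V) i j = z
  simp [Complex.normSq_apply]
  ring

theorem young {l k s : ℝ} (hl : 0 < l) (hk : 0 < k) (hs : s ∈ Set.Icc (0:ℝ) 1) :
    k ^ s ≤ (1 - s) * l ^ s + s * (l ^ (s - 1) * k) := by
  have y := Real.geom_mean_le_arith_mean2_weighted (sub_nonneg.2 hs.2) hs.1 hl.le hk.le
    (by ring)
  have e : l ^ (s - 1) * l ^ (1 - s) = 1 := by rw [← Real.rpow_add hl]; simp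
  have e2 : l ^ (s - 1) * l = l ^ s := by
    rw [← Real.rpow_add_one hl.ne']; congr 1; ring
  have hp : 0 < l ^ (s - 1) := Real.rpow_pos_of_pos hl _
  calc k ^ s = l ^ (s - 1) * (l ^ (1 - s) * k ^ s) := by rw [← mul_assoc, e, one_mul]
    _ ≤ l ^ (s - 1) * ((1 - s) * l + s * k) := by gcongr
    _ = _ := by rw [← e2]; ring

theorem klein_s4 {K L : Matrix (Fin n) (Fin n) ℂ} (hK : K.PosDef) (hL : L.PosDef) {s : ℝ}
    (hs : s ∈ Set.Icc (0:ℝ) 1) :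
    (Matrix.trace (mpow K s)).re ≤ (1 - s) * (Matrix.trace (mpow L s)).re +
      s * (Matrix.trace (mpow L (s - 1) * K)).re := by
  obtain ⟨w, hw, h⟩ := tr_two hL.isHermitian hK.isHermitian
  have h1 := h (fun _ => 1) (fun x => x ^ s)
  have h2 := h (fun x => x ^ s) (fun _ => 1)
  have h3 := h (fun x => x ^ (s - 1)) (fun x => x)
  rw [cfc_const_one ℝ L hL.isHermitian.isSelfAdjoint, one_mul] at h1
  rw [cfc_const_one ℝ K hK.isHermitian.isSelfAdjoint, mul_one] at h2
  rw [cfc_id_mat hK.isHermitian] at h3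
  simp only [mpow]
  rw [h1, h2, h3, Finset.mul_sum, Finset.mul_sum, ← Finset.sum_add_distrib]
  refine Finset.sum_le_sum fun i _ => ?_
  rw [Finset.mul_sum, Finset.mul_sum, ← Finset.sum_add_distrib]
  refine Finset.sum_le_sum fun j _ => ?_
  have hl := hL.eigenvalues_pos i
  have hk := hK.eigenvalues_pos j
  generalize hL.isHermitian.eigenvalues i = l at *
  generalize hK.isHermitian.eigenvalues j = k at *
  have := hw i j
  have key := young hl hk hs
  have := mul_le_mul_of_nonneg_right key this
  linarith

theorem conj_mpow {X : Matrix (Fin n) (Fin n) ℂ} (h1 : (X * star X).PosDef)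
    (h2 : (star X * X).PosDef) (s : ℝ) :
    mpow (X * star X) s = X * mpow (star X * X) (s - 1) * star X := by
  set R := mpow (star X * X) (-1/2) with hR
  have hRs : star R = R := (mpow_pd h2 _).isHermitian.eq
  have hX : mpow (star X * X) 1 = star X * X := mpow_one' h2.isHermitian
  have a1 : R * (star X * X) * R = 1 := by
    rw [← hX, hR, hX, ← hX, mpow_mpow h2, mpow_add_s4 h2, mpow_add_s4 h2]
    · norm_num
      exact mpow_zero' h2.isHermitian
  have hU1 : star (X * R) * (X * R) = 1 := by
    rw [star_mul, hRs, ← a1]; simp only [mul_assoc]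
  have hU2 : (X * R) * star (X * R) = 1 := mul_eq_one_comm.1 hU1
  let U : unitary (Matrix (Fin n) (Fin n) ℂ) := ⟨X * R, by
    rw [Unitary.mem_iff]; exact ⟨hU1, hU2⟩⟩
  have e := StarAlgHomClass.map_cfc (S := ℂ) (Unitary.conjStarAlgAut ℂ (Matrix (Fin n) (Fin n) ℂ) U)
    (fun x : ℝ => x ^ s) (star X * X) (aux_cont _ _) (by
      show Continuous fun x => (U : Matrix (Fin n) (Fin n) ℂ) * x * star (U : Matrix (Fin n) (Fin n) ℂ)
      fun_prop) h2.isHermitian.isSelfAdjoint (by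
      simp only [Unitary.conjStarAlgAut_apply]
      exact h2.isHermitian.isSelfAdjoint.conjugate _)
  simp only [Unitary.conjStarAlgAut_apply] at e
  have e1 : (U : Matrix (Fin n) (Fin n) ℂ) * (star X * X) * star (U : Matrix (Fin n) (Fin n) ℂ)
      = X * star X := by
    show X * R * (star X * X) * star (X * R) = _
    have : X * R * (star X * X) * star (X * R) = X * (R * (star X * X) * R) * star X := by
      rw [star_mul, hRs]; simp only [mul_assoc]
    rw [this, a1, mul_one]
  rw [e1] at e
  rw [mpow, ← e]
  show X * R * mpow (star X * X) s * star (X * R) = _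
  have : X * R * mpow (star X * X) s * star (X * R) =
      X * (R * mpow (star X * X) s * R) * star X := by
    rw [star_mul, hRs]; simp only [mul_assoc]
  rw [this, hR, mpow_add_s4 h2, mpow_add_s4 h2]
  congr 3; ring

/-- the auxiliary mean -/
noncomputable def mm (Y C : Matrix (Fin n) (Fin n) ℂ) (s : ℝ) : Matrix (Fin n) (Fin n) ℂ :=
  mpow Y (1/2) * mpow (mpow Y (1/2) * C * mpow Y (1/2)) (s - 1) * mpow Y (1/2)

theorem pd_conj {R C : Matrix (Fin n) (Fin n) ℂ} (hR : R.PosDef) (hC : C.PosDef) :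
    (R * C * R).PosDef := by
  have h := Matrix.isStrictlyPositive_iff_posDef.2 hR
  have : (R * C * R).PosSemidef := by
    have := hC.posSemidef.mul_mul_conjTranspose_same R
    rwa [hR.isHermitian.eq] at this
  rw [this.posDef_iff_isUnit]
  exact (hR.isUnit.mul hC.isUnit).mul hR.isUnit

theorem conj_le {R C C' : Matrix (Fin n) (Fin n) ℂ} (hR : R.IsHermitian) (h : C ≤ C') :
    R * C * R ≤ R * C' * R := by
  have := star_left_conjugate_le_conjugate h R
  rwa [show star R = R from hR.eq] at this

theorem mm_anti {Y C C' : Matrix (Fin n) (Fin n) ℂ} (hY : Y.PosDef) (hC : C.PosDef)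
    (hC' : C'.PosDef) (h : C ≤ C') {s : ℝ} (hs : s ∈ Set.Icc (0:ℝ) 1) :
    mm Y C' s ≤ mm Y C s := by
  have hW := mpow_pd hY (1/2)
  refine conj_le hW.isHermitian (mpow_anti_s4 ⟨by linarith [hs.1], by linarith [hs.2]⟩
    (pd_conj hW hC) (pd_conj hW hC') (conj_le hW.isHermitian h))

theorem mm_smul {Y : Matrix (Fin n) (Fin n) ℂ} (hY : Y.PosDef) {c : ℝ} (hc : 0 < c) (s : ℝ) :
    mm Y (c • 1) s = (c ^ (s - 1)) • mpow Y s := by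
  have e : mpow Y (1/2) * (c • 1) * mpow Y (1/2) = c • Y := by
    rw [mul_smul_comm, mul_one, smul_mul_assoc, mpow_add_s4 hY]
    norm_num
    rw [mpow_one' hY.isHermitian]
  rw [mm, e, mpow_smul_s4 hY hc, mul_smul_comm, smul_mul_assoc, mpow_add_s4 hY, mpow_add_s4 hY]
  congr 2; ring

theorem tr_mm {Y C : Matrix (Fin n) (Fin n) ℂ} (hY : Y.PosDef) (hC : C.PosDef) (s : ℝ) :
    Matrix.trace (C * mm Y C s) =
      Matrix.trace (mpow (mpow Y (1/2) * C * mpow Y (1/2)) s) := by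
  have hL := pd_conj (mpow_pd hY (1/2)) hC
  have e : mpow (mpow Y (1/2) * C * mpow Y (1/2)) s =
    mpow (mpow Y (1/2) * C * mpow Y (1/2)) (s - 1) * (mpow Y (1/2) * C * mpow Y (1/2)) := by
    conv_rhs => rw [← mpow_one' hL.isHermitian]
    rw [mpow_mpow hL, mpow_add_s4 hL]
    congr 1; ring
  rw [e, mm, ← mul_assoc, Matrix.trace_mul_comm, ← mul_assoc, ← mul_assoc, Matrix.trace_mul_comm]

theorem smul_pd {c : ℝ} (hc : 0 < c) : (c • (1 : Matrix (Fin n) (Fin n) ℂ)).PosDef :=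
  Matrix.PosDef.one.smul hc

theorem incr {Y C C' : Matrix (Fin n) (Fin n) ℂ} (hY : Y.PosDef) (hC : C.PosDef)
    (hC' : C'.PosDef) (h : C ≤ C') {s x : ℝ} (hs : s ∈ Set.Icc (0:ℝ) 1) (hx : 0 < x)
    (hx' : C' ≤ x • 1) :
    s * x ^ (s - 1) * (Matrix.trace ((C' - C) * mpow Y s)).re ≤
      (Matrix.trace (mpow (mpow Y (1/2) * C' * mpow Y (1/2)) s)).re -
      (Matrix.trace (mpow (mpow Y (1/2) * C * mpow Y (1/2)) s)).re := by
  have hW := mpow_pd hY (1/2)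
  have k := klein_s4 (pd_conj hW hC) (pd_conj hW hC') hs
  have e : Matrix.trace (mpow (mpow Y (1/2) * C' * mpow Y (1/2)) (s - 1) *
      (mpow Y (1/2) * C * mpow Y (1/2))) = Matrix.trace (C * mm Y C' s) := by
    rw [mm, ← mul_assoc, Matrix.trace_mul_comm, ← mul_assoc, ← mul_assoc, Matrix.trace_mul_comm]
  have a := mm_anti hY hC' (smul_pd hx) hx' hs
  rw [mm_smul hY hx] at a
  have b := tr_mono (Matrix.le_iff.1 h) a
  rw [mul_smul_comm, Matrix.trace_smul, Complex.smul_re, smul_eq_mul] at b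
  rw [sub_mul C' C (mm _ _ _), Matrix.trace_sub, Complex.sub_re, tr_mm hY hC'] at b
  rw [e] at k
  have := mul_le_mul_of_nonneg_left b hs.1
  linarith

theorem mono_of_step (D φ : ℝ → ℝ) {a b K : ℝ} (hab : a ≤ b)
    (h : ∀ x y, a ≤ x → x ≤ y → y ≤ b → - (K * (φ x - φ y) * (y - x)) ≤ D y - D x) :
    D a ≤ D b := by
  have key : ∀ N : ℕ, 0 < N → - (K * (φ a - φ b) * ((b - a) / N)) ≤ D b - D a := by
    intro N hN
    have hN' : (0:ℝ) < N := by exact_mod_cast hN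
    have ind : ∀ k : ℕ, k ≤ N → - (K * (φ a - φ (a + k * ((b - a) / N))) * ((b - a) / N)) ≤
        D (a + k * ((b - a) / N)) - D a := by
      intro k
      have hd : 0 ≤ (b - a) / N := div_nonneg (by linarith) hN'.le
      induction k with
      | zero => intro _; simp
      | succ k ih =>
        intro hk
        have h1 := ih (by omega)
        have h2 := h (a + k * ((b - a) / N)) (a + (k + 1 : ℕ) * ((b - a) / N))
          (by have := mul_nonneg (Nat.cast_nonneg (α := ℝ) k) hd; linarith)
          (by push_cast; linarith)
          (by
            have : ((k + 1 : ℕ) : ℝ) ≤ N := by exact_mod_cast hk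
            have := mul_le_mul_of_nonneg_right this hd
            rw [mul_div_cancel₀ _ hN'.ne'] at this
            linarith)
        have e : a + (k + 1 : ℕ) * ((b - a) / N) - (a + k * ((b - a) / N)) = (b - a) / N := by
          push_cast; ring
        rw [e] at h2
        linarith
    have := ind N le_rfl
    rw [mul_div_cancel₀ _ hN'.ne'] at this
    simpa using this
  have l : Filter.Tendsto (fun N : ℕ => - (K * (φ a - φ b) * ((b - a) / N))) Filter.atTop
      (nhds (- (K * (φ a - φ b) * 0))) :=
    ((tendsto_const_div_atTop_nhds_zero_nat _).const_mul _).neg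
  have := le_of_tendsto l (Filter.eventually_atTop.2 ⟨1, fun N hN => key N hN⟩)
  linarith [this, mul_zero (K * (φ a - φ b))]

theorem scal {l x y s : ℝ} (hx : 0 < x) (hxy : x ≤ y) (hs : s ∈ Set.Icc (0:ℝ) 1) :
    (min l y) ^ s - (min l x) ^ s ≤ s * y ^ (s - 1) * (min l y - min l x) +
      (s * x ^ (s - 1) - s * y ^ (s - 1)) * (y - x) := by
  have hφ : 0 ≤ s * x ^ (s - 1) - s * y ^ (s - 1) := by
    rw [← mul_sub]
    refine mul_nonneg hs.1 (sub_nonneg.2 ?_)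
    exact Real.rpow_le_rpow_of_nonpos hx hxy (by linarith [hs.2])
  rcases le_total l x with h | h
  · rw [min_eq_left h, min_eq_left (h.trans hxy)]
    have := mul_nonneg hφ (sub_nonneg.2 hxy)
    linarith
  · rw [min_eq_right h]
    have hv1 : x ≤ min l y := le_min h hxy
    have hv2 : min l y ≤ y := min_le_right _ _
    generalize min l y = v at *
    have yy := young hx (hx.trans_le hv1) hs
    have e2 : x ^ (s - 1) * x = x ^ s := by
      rw [← Real.rpow_add_one hx.ne']; congr 1; ring
    have := mul_le_mul_of_nonneg_left (sub_le_sub_right hv2 x) hφ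
    have e3 : s * (x ^ (s - 1) * x) = s * x ^ s := by rw [e2]
    linarith

theorem alt {Y C : Matrix (Fin n) (Fin n) ℂ} (hY : Y.PosDef) (hC : C.PosDef) {s : ℝ}
    (hs : s ∈ Set.Icc (0:ℝ) 1) :
    (Matrix.trace (mpow C s * mpow Y s)).re ≤
      (Matrix.trace (mpow (mpow Y (1/2) * C * mpow Y (1/2)) s)).re := by
  have hfin := C.finite_real_spectrum
  have hH := hC.isHermitian
  obtain ⟨a, ha, haC⟩ : ∃ a : ℝ, 0 < a ∧ ∀ x ∈ spectrum ℝ C, a ≤ x := by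
    rcases (spectrum ℝ C).eq_empty_or_nonempty with h | h
    · exact ⟨1, one_pos, by simp [h]⟩
    · obtain ⟨a, ha, h⟩ := Set.exists_min_image _ id hfin h
      exact ⟨a, spec_pos hC ha, h⟩
  obtain ⟨b, hab, hbC⟩ : ∃ b : ℝ, a ≤ b ∧ ∀ x ∈ spectrum ℝ C, x ≤ b := by
    obtain ⟨b, hb⟩ := hfin.bddAbove
    exact ⟨max a b, le_max_left _ _, fun x hx => (hb hx).trans (le_max_right _ _)⟩
  obtain ⟨m, hm0, hm⟩ := tr_one hH (mpow Y s)
  have hm0 := hm0 (mpow_pd hY s).posSemidef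
  let Cx : ℝ → Matrix (Fin n) (Fin n) ℂ := fun x => cfc (fun u => min u x) C
  have hCx : ∀ x, 0 < x → (Cx x).PosDef := fun x hx =>
    cfc_pd hH fun u hu => lt_min (spec_pos hC hu) hx
  have hCs : ∀ x, mpow (Cx x) s = cfc (fun u => (min u x) ^ s) C := fun x => mpow_cfc hH _ s
  have := mono_of_step (fun x =>
    (Matrix.trace (mpow (mpow Y (1/2) * Cx x * mpow Y (1/2)) s)).re -
    (Matrix.trace (mpow (Cx x) s * mpow Y s)).re) (fun x => s * x ^ (s - 1))
    (K := ∑ i, m i) hab (by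
      intro x y hax hxy hyb
      have hx : 0 < x := ha.trans_le hax
      have hy : 0 < y := hx.trans_le hxy
      have h1 := incr hY (hCx x hx) (hCx y hy)
        (cfc_mono (fun u _ => min_le_min_left u hxy) (aux_cont _ _) (aux_cont _ _)) hs hy
        (by
          have := cfc_le_algebraMap (fun u => min u y) y C (fun u _ => min_le_right u y)
            (aux_cont _ _) hH.isSelfAdjoint
          rwa [Algebra.algebraMap_eq_smul_one] at this)
      have e : Cx y - Cx x = cfc (fun u => min u y - min u x) C :=
        (cfc_sub _ _ _ (aux_cont _ _) (aux_cont _ _)).symm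
      rw [e, hm] at h1
      simp only [hCs]
      rw [hm, hm]
      have h2 : ∑ i, ((min (hH.eigenvalues i) y) ^ s - (min (hH.eigenvalues i) x) ^ s) * m i ≤
        ∑ i, (s * y ^ (s - 1) * (min (hH.eigenvalues i) y - min (hH.eigenvalues i) x) +
          (s * x ^ (s - 1) - s * y ^ (s - 1)) * (y - x)) * m i :=
        Finset.sum_le_sum fun i _ => mul_le_mul_of_nonneg_right (scal hx hxy hs) (hm0 i)
      simp only [add_mul, Finset.sum_add_distrib, ← Finset.mul_sum, sub_mul (_ ^ s) (_ ^ s),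
        Finset.sum_sub_distrib, mul_assoc (s * y ^ (s - 1))] at h2
      linarith)
  have ea : Cx a = a • 1 := by
    rw [← Algebra.algebraMap_eq_smul_one, ← cfc_const a C hH.isSelfAdjoint]
    exact cfc_congr fun u hu => min_eq_right (haC u hu)
  have eb : Cx b = C := by
    conv_rhs => rw [← cfc_id_mat hH]
    exact cfc_congr fun u hu => min_eq_left (hbC u hu)
  have eas : mpow (Cx a) s = (a ^ s) • 1 := by
    rw [hCs, ← Algebra.algebraMap_eq_smul_one, ← cfc_const (a ^ s) C hH.isSelfAdjoint]
    exact cfc_congr fun u hu => by simp only [min_eq_right (haC u hu)]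
  have e : mpow Y (1/2) * (a • 1) * mpow Y (1/2) = a • Y := by
    rw [mul_smul_comm, mul_one, smul_mul_assoc, mpow_add_s4 hY]
    norm_num
    rw [mpow_one' hY.isHermitian]
  simp only [eb, eas] at this
  rw [ea, e, mpow_smul_s4 hY ha, smul_mul_assoc, one_mul] at this
  linarith

theorem abel {ι : Type*} (l m : ι → ℝ) (S : Finset ι)
    (h : ∀ j ∈ S, 0 ≤ ∑ i ∈ S with l j ≤ l i, m i) (g : ℝ → ℝ)
    (hg : ∀ i ∈ S, 0 ≤ g (l i)) (hmono : ∀ i ∈ S, ∀ j ∈ S, l i ≤ l j → g (l i) ≤ g (l j)) :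
    0 ≤ ∑ i ∈ S, g (l i) * m i := by
  classical
  induction S using Finset.strongInduction generalizing g with
  | H S ih =>
    rcases S.eq_empty_or_nonempty with rfl | hS
    · simp
    obtain ⟨i0, hi0, hmin⟩ := Finset.exists_min_image S l hS
    have e : ∑ i ∈ S, g (l i) * m i =
        ∑ i ∈ S with l i0 < l i, (g (l i) - g (l i0)) * m i + g (l i0) * ∑ i ∈ S, m i := by
      rw [Finset.sum_filter, Finset.mul_sum, ← Finset.sum_add_distrib]
      refine Finset.sum_congr rfl fun i hi => ?_
      split_ifs with hlt
      · ring
      · rw [le_antisymm (not_lt.1 hlt) (hmin i hi)]; ring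
    rw [e]
    have h0 := h i0 hi0
    rw [Finset.filter_true_of_mem hmin] at h0
    refine add_nonneg ?_ (mul_nonneg (hg i0 hi0) h0)
    refine ih (S.filter fun i => l i0 < l i) ?_ ?_ (fun x => g x - g (l i0)) ?_ ?_
    · exact Finset.filter_ssubset.2 ⟨i0, hi0, lt_irrefl _⟩
    · intro j hj
      rw [Finset.mem_filter] at hj
      convert h j hj.1 using 1
      rw [Finset.filter_filter]
      refine Finset.sum_congr (Finset.filter_congr fun i _ => ?_) fun _ _ => rfl
      exact ⟨fun h => h.2, fun h => ⟨hj.2.trans_le h, h⟩⟩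
    · intro i hi
      rw [Finset.mem_filter] at hi
      exact sub_nonneg.2 (hmono i0 hi0 i hi.1 hi.2.le)
    · intro i hi j hj hij
      rw [Finset.mem_filter] at hi hj
      exact sub_le_sub_right (hmono i hi.1 j hj.1 hij) _

theorem pstep {Y C : Matrix (Fin n) (Fin n) ℂ} (hY : Y.PosDef) (hC : C.PosDef) {s : ℝ}
    (hs : s ∈ Set.Icc (0:ℝ) 1) {c : ℝ} (hc : 0 < c) :
    (Matrix.trace (cfc (fun x => if c ≤ x then 1 else 0) C * (mpow C s * mpow Y s))).re ≤
    (Matrix.trace (cfc (fun x => if c ≤ x then 1 else 0) C *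
      mpow (mpow C (1/2) * Y * mpow C (1/2)) s)).re := by
  have hH := hC.isHermitian
  have hW := mpow_pd hY (1/2)
  have hR := mpow_pd hC (1/2)
  set W := mpow Y (1/2) with hWdef
  set R := mpow C (1/2) with hRdef
  set p : ℝ → ℝ := fun x => if c ≤ x then 1 else 0 with hp
  have hWW : W * W = Y := by
    rw [hWdef, mpow_add_s4 hY]; norm_num; exact mpow_one' hY.isHermitian
  have hRR : R * R = C := by
    rw [hRdef, mpow_add_s4 hC]; norm_num; exact mpow_one' hH
  -- rewriting of the power
  have hsW : star W = W := hW.isHermitian.eq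
  have hsR : star R = R := hR.isHermitian.eq
  have x1 : (R * W) * star (R * W) = R * Y * R := by
    rw [star_mul, hsW, hsR, ← hWW]; simp only [mul_assoc]
  have x2 : star (R * W) * (R * W) = W * C * W := by
    rw [star_mul, hsW, hsR, ← hRR]; simp only [mul_assoc]
  have hz := conj_mpow (X := R * W) (by rw [x1]; exact pd_conj hR hY)
    (by rw [x2]; exact pd_conj hW hC) s
  rw [x1, x2] at hz
  have hz2 : mpow (R * Y * R) s = R * mm Y C s * R := by
    rw [hz, mm, star_mul, hsW, hsR]; simp only [mul_assoc, ← hWdef]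
  have t1 : Matrix.trace (cfc p C * mpow (R * Y * R) s) =
      Matrix.trace (cfc (fun x => p x * x) C * mm Y C s) := by
    rw [hz2, ← mul_assoc, ← mul_assoc, Matrix.trace_mul_comm, ← mul_assoc, ← mul_assoc]
    congr 2
    rw [hRdef, mpow, cfc_mul_mat, cfc_mul_mat]
    refine cfc_congr fun x hx => ?_
    have := spec_pos hC hx
    have e : x ^ (1/2 : ℝ) * x ^ (1/2 : ℝ) = x := by
      rw [← Real.rpow_add this]; norm_num
    calc x ^ (1/2 : ℝ) * p x * x ^ (1/2 : ℝ) = p x * (x ^ (1/2 : ℝ) * x ^ (1/2 : ℝ)) := by ring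
      _ = _ := by rw [e]
  set C' := cfc (fun x => max x c) C with hC'def
  have hC' : C'.PosDef := cfc_pd hH fun x _ => lt_max_of_lt_right hc
  have hCC' : C ≤ C' := by
    conv_lhs => rw [← cfc_id_mat hH]
    exact cfc_mono (fun u _ => le_max_left u c) (aux_cont _ _) (aux_cont _ _)
  have hcC' : c • 1 ≤ C' := by
    have := algebraMap_le_cfc (fun u => max u c) c C (fun u _ => le_max_right u c)
            (aux_cont _ _) hH.isSelfAdjoint
    rwa [Algebra.algebraMap_eq_smul_one] at this
  have s1 := tr_mono (X := cfc (fun x => p x * x) C) (cfc_psd fun x hx => by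
    have := spec_pos hC hx
    simp only [hp]; split_ifs <;> simp [this.le]) (mm_anti hY hC hC' hCC' hs)
  have s2 := tr_mono (X := cfc (fun x => 1 - p x) C) (cfc_psd fun x hx => by
    simp only [hp]; split_ifs <;> simp) (mm_anti hY (smul_pd hc) hC' hcC' hs)
  rw [mm_smul hY hc, mul_smul_comm, Matrix.trace_smul, Complex.smul_re, smul_eq_mul] at s2
  have s3 := alt hY hC' hs
  rw [← tr_mm hY hC', mpow_cfc hH] at s3
  rw [t1]
  refine le_trans ?_ s1
  have e0 : cfc p C * (mpow C s * mpow Y s) = cfc (fun x => p x * x ^ s) C * mpow Y s := by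
    rw [← mul_assoc, mpow.eq_def C, cfc_mul_mat]
  rw [e0]
  obtain ⟨m, -, hm⟩ := tr_one hH (mpow Y s)
  obtain ⟨k, -, hk⟩ := tr_one hH (mm Y C' s)
  rw [hm, hk] at s2
  rw [hm, hC'def, hk] at s3
  rw [hm, hk]
  have f1 : ∀ i, max (hH.eigenvalues i) c * k i = p (hH.eigenvalues i) * hH.eigenvalues i * k i +
      c * ((1 - p (hH.eigenvalues i)) * k i) := by
    intro i
    simp only [hp]; split_ifs with h
    · rw [max_eq_left h]; ring
    · rw [max_eq_right (not_le.1 h).le]; ring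
  have f2 : ∀ i, max (hH.eigenvalues i) c ^ s * m i =
      p (hH.eigenvalues i) * hH.eigenvalues i ^ s * m i +
      c ^ s * ((1 - p (hH.eigenvalues i)) * m i) := by
    intro i
    simp only [hp]; split_ifs with h
    · rw [max_eq_left h]; ring
    · rw [max_eq_right (not_le.1 h).le]; ring
  simp only [f1, f2, Finset.sum_add_distrib, ← Finset.mul_sum] at s3
  have e2 : c * c ^ (s - 1) = c ^ s := by
    rw [mul_comm, ← Real.rpow_add_one hc.ne']; congr 1; ring
  have s4 := mul_le_mul_of_nonneg_left s2 hc.le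
  rw [← mul_assoc, e2] at s4
  linarith

theorem main_pd {Y C : Matrix (Fin n) (Fin n) ℂ} (hY : Y.PosDef) (hC : C.PosDef) {s q : ℝ}
    (hs : s ∈ Set.Icc (0:ℝ) 1) (hq : 0 ≤ q) :
    (Matrix.trace (mpow C q * (mpow C s * mpow Y s))).re ≤
    (Matrix.trace (mpow C q * mpow (mpow C (1/2) * Y * mpow C (1/2)) s)).re := by
  have hH := hC.isHermitian
  obtain ⟨m, -, hm⟩ := tr_one hH
    (mpow (mpow C (1/2) * Y * mpow C (1/2)) s - mpow C s * mpow Y s)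
  have key := abel hH.eigenvalues m Finset.univ (fun j _ => by
      have := pstep hY hC hs (hC.eigenvalues_pos j)
      rw [← sub_nonneg, ← Complex.sub_re, ← Matrix.trace_sub, ← mul_sub, hm] at this
      rw [Finset.sum_filter]
      simpa using this) (fun x => x ^ q)
    (fun i _ => Real.rpow_nonneg (hC.eigenvalues_pos i).le q)
    (fun i _ j _ h => Real.rpow_le_rpow (hC.eigenvalues_pos i).le h hq)
  rw [← hm (fun x => x ^ q), mul_sub, Matrix.trace_sub, Complex.sub_re] at key
  simp only [mpow] at key ⊢
  linarith

theorem stmt_pd {A B : Matrix (Fin n) (Fin n) ℂ} (hA : A.PosDef) (hB : B.PosDef) {s t : ℝ}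
    (hs : s ∈ Set.Icc (0:ℝ) 1) (ht : t ≤ -s) :
    (Matrix.trace (mpow A t * mpow (mpow A (1/2) * B * mpow A (1/2)) s)).re ≤
      (Matrix.trace (mpow A (t + s) * mpow B s)).re := by
  have hR := mpow_pd hA (1/2)
  have h := main_pd (pd_conj hR hB) (mpow_pd hA (-1)) hs (q := -(t + s)) (by linarith)
  simp only [mpow_mpow hA] at h
  rw [← mul_assoc, mpow_add_s4 hA] at h
  have e : mpow A (-1 * (1/2)) * (mpow A (1/2) * B * mpow A (1/2)) * mpow A (-1 * (1/2)) = B := by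
    have e1 : mpow A (-1 * (1/2)) * mpow A (1/2) = 1 := by
      rw [mpow_add_s4 hA]; norm_num; exact mpow_zero' hA.isHermitian
    have e2 : mpow A (1/2) * mpow A (-1 * (1/2)) = 1 := by
      rw [mpow_add_s4 hA]; norm_num; exact mpow_zero' hA.isHermitian
    calc _ = (mpow A (-1 * (1/2)) * mpow A (1/2)) * B * (mpow A (1/2) * mpow A (-1 * (1/2))) := by
          simp only [mul_assoc]
      _ = B := by rw [e1, e2, one_mul, mul_one]
  rw [e] at h
  have e1 : -1 * -(t + s) = t + s := by ring
  have e2 : t + s + -1 * s = t := by ring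
  rwa [e1, e2] at h

theorem stmt_psd {A B : Matrix (Fin n) (Fin n) ℂ} (hA : A.PosDef) (hB : B.PosSemidef) {s t : ℝ}
    (hs : s ∈ Set.Icc (0:ℝ) 1) (ht : t ≤ -s) :
    (Matrix.trace (mpow A t * mpow (mpow A (1/2) * B * mpow A (1/2)) s)).re ≤
      (Matrix.trace (mpow A (t + s) * mpow B s)).re := by
  have hR := mpow_pd hA (1/2)
  have hZ : (mpow A (1/2) * B * mpow A (1/2)).PosSemidef := by
    have := hB.mul_mul_conjTranspose_same (mpow A (1/2))
    rwa [hR.isHermitian.eq] at this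
  rcases hs.1.eq_or_lt with h0 | h0
  · rw [← h0, mpow_zero' hZ.isHermitian, mpow_zero' hB.isHermitian, add_zero]
  set K := (Matrix.trace (mpow A (t + s))).re with hK
  have hK0 : 0 ≤ K := (Complex.le_def.1 (mpow_pd hA (t + s)).posSemidef.trace_nonneg).1
  refine le_of_forall_pos_le_add fun δ hδ => ?_
  set ε := (δ / (K + 1)) ^ (1 / s) with hε
  have hd : 0 < δ / (K + 1) := by positivity
  have hε0 : 0 < ε := Real.rpow_pos_of_pos hd _
  have hεs : ε ^ s * K ≤ δ := by
    rw [hε, ← Real.rpow_mul hd.le, one_div_mul_cancel h0.ne', Real.rpow_one, div_mul_eq_mul_div,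
      div_le_iff₀ (by positivity)]
    nlinarith
  have hBε : (B + ε • 1).PosDef := (smul_pd hε0).posSemidef_add hB
  have hle : B ≤ B + ε • 1 := by
    rw [Matrix.le_iff, add_sub_cancel_left]; exact (smul_pd hε0).posSemidef
  have h1 := tr_mono (mpow_pd hA t).posSemidef (mpow_mono hs hZ (conj_le hR.isHermitian hle))
  have h2 := stmt_pd hA hBε hs ht
  have e : B + ε • 1 = cfc (fun x => x + ε) B := by
    rw [cfc_add_const _ _ _ (aux_cont _ _) hB.isHermitian.isSelfAdjoint,
      cfc_id_mat hB.isHermitian, Algebra.algebraMap_eq_smul_one]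
  have h3 : mpow (B + ε • 1) s ≤ mpow B s + (ε ^ s) • 1 := by
    rw [e, mpow_cfc hB.isHermitian, ← Algebra.algebraMap_eq_smul_one, mpow,
      ← cfc_add_const _ _ _ (aux_cont _ _) hB.isHermitian.isSelfAdjoint]
    refine cfc_mono (fun x hx => ?_) (aux_cont _ _) (aux_cont _ _)
    exact Real.rpow_add_le_add_rpow (spec_nonneg hB hx) hε0.le hs.1 hs.2
  have h4 := tr_mono (mpow_pd hA (t + s)).posSemidef h3
  rw [mul_add, mul_smul_comm, mul_one, Matrix.trace_add, Matrix.trace_smul, Complex.add_re,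
    Complex.smul_re, smul_eq_mul, ← hK] at h4
  linarith

end Aux

/-- Lemma 3: for `A` positive definite, `B` positive semidefinite, `s ∈ [0,1]` and `t ≤ -s`:
`Tr[A^t (A^{1/2} B A^{1/2})^s] ≤ Tr[A^t A^s B^s] = Tr[A^{t+s} B^s]`. -/
theorem stmt_4 {n : ℕ} (A B : Matrix (Fin n) (Fin n) ℂ)
    (hA : A.PosDef) (hB : B.PosSemidef)
    (s t : ℝ) (hs : s ∈ Set.Icc (0 : ℝ) 1) (ht : t ≤ -s) :
    (Matrix.trace (mpow A t * mpow (mpow A (1/2) * B * mpow A (1/2)) s)).re ≤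
      (Matrix.trace (mpow A t * mpow A s * mpow B s)).re ∧
    Matrix.trace (mpow A t * mpow A s * mpow B s) =
      Matrix.trace (mpow A (t + s) * mpow B s) := by
  have e : mpow A t * mpow A s = mpow A (t + s) := mpow_add_s4 hA t s
  rw [e]
  exact ⟨stmt_psd hA hB hs ht, rfl⟩
end
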